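/- Let K and L be nonempty compact convex sets in ℝⁿ and let 1 ≤ q ≤ p ≤ n be integers. Then MV(K^{(q)}, L^{(n−q)})^p ≥ MV(K^{(p)}, L^{(n−p)})^q · (n! · vol(L))^{p−q}. (Corollary 7.4(1), using deg(ℓ^n) = MV(L,…,L) = n!·vol(L).) -/

import Mathlib

open scoped Pointwise
open MeasureTheory Finset

/-- Lebesgue volume of a subset of ℝⁿ, as a real number. -/
noncomputable def vol {n : ℕ} (A : Set (Fin n → ℝ)) : ℝ := (volume A).toReal

/-- The mixed volume of `n` convex bodies in ℝⁿ, defined by the inclusion–exclusion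
formula. -/
noncomputable def MV (n : ℕ) (K : Fin n → Set (Fin n → ℝ)) : ℝ :=
  ∑ j ∈ Finset.Icc 1 n, (-1 : ℝ) ^ (n - j) *
    ∑ S ∈ Finset.univ.powersetCard j, vol (∑ i ∈ S, K i)


namespace AFx

lemma bm1_compact {A B C : Set ℝ} (hA : IsCompact A) (hB : IsCompact B) (hAn : A.Nonempty)
    (hBn : B.Nonempty) (h : ∀ x ∈ A, ∀ y ∈ B, (x + y) * (1/2) ∈ C) :
    volume A + volume B ≤ 2 * volume C := by
  obtain ⟨a, haA, ha⟩ := hA.exists_isGreatest hAn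
  obtain ⟨b, hbB, hb⟩ := hB.exists_isLeast hBn
  set m := (a + b) * (1/2) with hm
  have key : ∀ (D : Set ℝ) (c : ℝ), volume ((fun x => (x + c)) ⁻¹' ((fun x => x * (1/2)) ⁻¹' D))
      = 2 * volume D := by
    intro D c
    rw [measure_preimage_add_right, Real.volume_preimage_mul_right (by norm_num)]
    norm_num
  have h1 : volume A ≤ 2 * volume (C ∩ Set.Iic m) := by
    rw [← key _ b]
    apply measure_mono
    intro x hx
    refine ⟨h x hx b hbB, ?_⟩
    have := ha hx
    simp only [Set.mem_Iic, hm]; linarith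
  have h2 : volume B ≤ 2 * volume (C \ Set.Iic m) := by
    have h3 : volume B ≤ volume (B \ {b}) := by
      rw [measure_sdiff_null (by simp)]
    refine h3.trans ?_
    rw [← key _ a]
    apply measure_mono
    intro x hx
    refine ⟨by have := h a haA x hx.1; simpa [add_comm] using this, ?_⟩
    have h4 := hb hx.1
    have h5 : b < x := lt_of_le_of_ne h4 (fun e => hx.2 (by simp [e]))
    simp only [Set.mem_Iic, hm]; linarith
  calc volume A + volume B ≤ 2 * volume (C ∩ Set.Iic m) + 2 * volume (C \ Set.Iic m) :=
        add_le_add h1 h2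
    _ = 2 * volume C := by
        rw [← mul_add, measure_inter_add_sdiff _ measurableSet_Iic]

lemma bm1 {A B C : Set ℝ} (hA : MeasurableSet A) (hB : MeasurableSet B) (hAn : A.Nonempty)
    (hBn : B.Nonempty) (h : ∀ x ∈ A, ∀ y ∈ B, (x + y) * (1/2) ∈ C) :
    volume A + volume B ≤ 2 * volume C := by
  obtain ⟨a, ha⟩ := hAn
  obtain ⟨b, hb⟩ := hBn
  rw [hA.measure_eq_iSup_isCompact, hB.measure_eq_iSup_isCompact]
  have : ∀ (K1 K2 : Set ℝ), K1 ⊆ A → IsCompact K1 → K2 ⊆ B → IsCompact K2 →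
      volume K1 + volume K2 ≤ 2 * volume C := by
    intro K1 K2 h1 h2 h3 h4
    refine le_trans (add_le_add (measure_mono (Set.subset_insert a K1))
      (measure_mono (Set.subset_insert b K2))) ?_
    apply bm1_compact (h2.insert a) (h4.insert b) (Set.insert_nonempty _ _)
      (Set.insert_nonempty _ _)
    intro x hx y hy
    apply h
    · rcases hx with rfl | hx
      exacts [ha, h1 hx]
    · rcases hy with rfl | hy
      exacts [hb, h3 hy]
  simp only [iSup_and']
  exact ENNReal.biSup_add_biSup_le' ⟨∅, by simp⟩ ⟨∅, by simp⟩
    fun K1 h1 K2 h2 => this K1 K2 h1.1 h1.2 h2.1 h2.2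

lemma pl1_norm {f g h : ℝ → ℝ} (hf : Measurable f) (hg : Measurable g) (hh : Measurable h)
    (f0 : ∀ x, 0 ≤ f x) (g0 : ∀ x, 0 ≤ g x) (h0 : ∀ x, 0 ≤ h x)
    (f1 : ∀ x, f x ≤ 1) (g1 : ∀ x, g x ≤ 1)
    (fs : ∀ t < 1, ∃ x, t < f x) (gs : ∀ t < 1, ∃ x, t < g x)
    (hfg : ∀ x y, f x * g y ≤ h ((x + y) * (1/2)) ^ 2) :
    (∫⁻ x, ENNReal.ofReal (f x)) + ∫⁻ x, ENNReal.ofReal (g x) ≤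
      2 * ∫⁻ x, ENNReal.ofReal (h x) := by
  rw [lintegral_eq_lintegral_meas_lt _ (Filter.Eventually.of_forall f0) hf.aemeasurable,
    lintegral_eq_lintegral_meas_lt _ (Filter.Eventually.of_forall g0) hg.aemeasurable,
    lintegral_eq_lintegral_meas_lt _ (Filter.Eventually.of_forall h0) hh.aemeasurable]
  have hmeas : ∀ k : ℝ → ℝ, Measurable fun t : ℝ => volume {a | t < k a} := fun k =>
    Antitone.measurable fun s t hst => measure_mono fun x (hx : t < k x) => lt_of_le_of_lt hst hx
  rw [← lintegral_add_left (hmeas f), ← lintegral_const_mul _ (hmeas h)]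
  apply setLIntegral_mono (by fun_prop (disch := exact hmeas h))
  intro t ht
  by_cases ht1 : t < 1
  · apply bm1 (measurableSet_lt measurable_const hf) (measurableSet_lt measurable_const hg)
      (fs t ht1) (gs t ht1)
    intro x hx y hy
    have ht0 : 0 < t := ht
    have hx' : t < f x := hx
    have hy' : t < g y := hy
    have h1 := hfg x y
    show t < h _
    by_contra hc
    push Not at hc
    have := h0 ((x + y) * (1/2))
    nlinarith
  · have e1 : {a | t < f a} = ∅ := by
      ext x; simp; linarith [f1 x]
    have e2 : {a | t < g a} = ∅ := by
      ext x; simp; linarith [g1 x]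
    simp [e1, e2]

lemma ennreal_amgm (a b c : ENNReal) (h : a + b ≤ 2 * c) : a * b ≤ c ^ 2 := by
  rcases eq_or_ne c ⊤ with rfl | hc
  · simp
  have hab : a + b ≠ ⊤ := ne_top_of_le_ne_top (ENNReal.mul_ne_top (by simp) hc) h
  have ha : a ≠ ⊤ := fun e => hab (by simp [e])
  have hb : b ≠ ⊤ := fun e => hab (by simp [e])
  lift a to NNReal using ha
  lift b to NNReal using hb
  lift c to NNReal using hc
  norm_cast at h ⊢
  have h' : (a : ℝ) + b ≤ 2 * c := by exact_mod_cast h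
  have : (a : ℝ) * b ≤ c ^ 2 := by nlinarith [sq_nonneg ((a : ℝ) - b), a.2, b.2, c.2]
  exact_mod_cast this

lemma pl1_bdd {f g h : ℝ → ENNReal} (hf : Measurable f) (hg : Measurable g) (hh : Measurable h)
    (k : NNReal) (fk : ∀ x, f x ≤ k) (gk : ∀ x, g x ≤ k)
    (hfg : ∀ x y, f x * g y ≤ h ((x + y) * (1/2)) ^ 2) :
    (∫⁻ x, f x) * ∫⁻ x, g x ≤ (∫⁻ x, h x) ^ 2 := by
  by_cases hf0 : ⨆ x, f x = 0
  · have : ∀ x, f x = 0 := fun x => le_antisymm (hf0 ▸ le_iSup f x) bot_le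
    simp [this]
  by_cases hg0 : ⨆ x, g x = 0
  · have : ∀ x, g x = 0 := fun x => le_antisymm (hg0 ▸ le_iSup g x) bot_le
    simp [this]
  have hft : ⨆ x, f x ≠ ⊤ := ne_top_of_le_ne_top ENNReal.coe_ne_top (iSup_le fk)
  have hgt : ⨆ x, g x ≠ ⊤ := ne_top_of_le_ne_top ENNReal.coe_ne_top (iSup_le gk)
  set a := (⨆ x, f x).toReal with ha
  set b := (⨆ x, g x).toReal with hb
  have a0 : 0 < a := ENNReal.toReal_pos hf0 hft
  have b0 : 0 < b := ENNReal.toReal_pos hg0 hgt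
  have fa : ∀ x, (f x).toReal ≤ a := fun x => ENNReal.toReal_mono hft (le_iSup f x)
  have gb : ∀ x, (g x).toReal ≤ b := fun x => ENNReal.toReal_mono hgt (le_iSup g x)
  have ft : ∀ x, f x ≠ ⊤ := fun x => ne_top_of_le_ne_top ENNReal.coe_ne_top (fk x)
  have gt : ∀ x, g x ≠ ⊤ := fun x => ne_top_of_le_ne_top ENNReal.coe_ne_top (gk x)
  set c := Real.sqrt (a * b) with hc
  have c0 : 0 < c := Real.sqrt_pos.2 (mul_pos a0 b0)
  have c2 : c ^ 2 = a * b := Real.sq_sqrt (mul_pos a0 b0).le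
  have mt : ∀ x, min (h x) (ENNReal.ofReal c) ≠ ⊤ := fun x =>
    ne_top_of_le_ne_top ENNReal.ofReal_ne_top (min_le_right _ _)
  have ex : ∀ (F : ℝ → ENNReal) (d : ℝ), 0 < d → Measurable F → (∀ x, F x ≠ ⊤) →
      ∫⁻ x, F x = ENNReal.ofReal d * ∫⁻ x, ENNReal.ofReal ((F x).toReal / d) := by
    intro F d hd hF hFt
    rw [← lintegral_const_mul _ (by fun_prop)]
    refine lintegral_congr fun x => ?_
    rw [← ENNReal.ofReal_mul hd.le, mul_div_cancel₀ _ hd.ne', ENNReal.ofReal_toReal (hFt x)]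
  have main := pl1_norm (f := fun x => (f x).toReal / a) (g := fun x => (g x).toReal / b)
    (h := fun x => (min (h x) (ENNReal.ofReal c)).toReal / c) (by fun_prop) (by fun_prop)
    (by fun_prop) (fun x => by positivity) (fun x => by positivity) (fun x => by positivity)
    (fun x => by rw [div_le_one a0]; exact fa x) (fun x => by rw [div_le_one b0]; exact gb x)
    (fun t ht => by
      by_cases ht0 : t < 0
      · exact ⟨0, lt_of_lt_of_le ht0 (by positivity)⟩
      push Not at ht0
      have : ENNReal.ofReal (t * a) < ⨆ x, f x := by
        rw [ENNReal.ofReal_lt_iff_lt_toReal (by positivity) hft]; nlinarith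
      obtain ⟨x, hx⟩ := lt_iSup_iff.1 this
      refine ⟨x, ?_⟩
      rw [ENNReal.ofReal_lt_iff_lt_toReal (by positivity) (ft x)] at hx
      rwa [lt_div_iff₀ a0])
    (fun t ht => by
      by_cases ht0 : t < 0
      · exact ⟨0, lt_of_lt_of_le ht0 (by positivity)⟩
      push Not at ht0
      have : ENNReal.ofReal (t * b) < ⨆ x, g x := by
        rw [ENNReal.ofReal_lt_iff_lt_toReal (by positivity) hgt]; nlinarith
      obtain ⟨x, hx⟩ := lt_iSup_iff.1 this
      refine ⟨x, ?_⟩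
      rw [ENNReal.ofReal_lt_iff_lt_toReal (by positivity) (gt x)] at hx
      rwa [lt_div_iff₀ b0])
    (fun x y => by
      rw [div_mul_div_comm, div_pow, c2, div_le_div_iff_of_pos_right (mul_pos a0 b0)]
      rcases le_total (h ((x + y) * (1/2))) (ENNReal.ofReal c) with hm | hm
      · rw [min_eq_left hm, ← ENNReal.toReal_mul, ← ENNReal.toReal_pow]
        exact ENNReal.toReal_mono (ENNReal.pow_ne_top
          (ne_top_of_le_ne_top ENNReal.ofReal_ne_top hm)) (hfg x y)
      · rw [min_eq_right hm, ENNReal.toReal_ofReal c0.le, c2]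
        exact mul_le_mul (fa x) (gb y) ENNReal.toReal_nonneg a0.le)
  have main2 := ennreal_amgm _ _ _ main
  rw [ex f a a0 hf ft, ex g b b0 hg gt]
  calc _ = ENNReal.ofReal c ^ 2 * ((∫⁻ x, ENNReal.ofReal ((f x).toReal / a)) *
        ∫⁻ x, ENNReal.ofReal ((g x).toReal / b)) := by
        rw [← ENNReal.ofReal_pow c0.le, c2, ENNReal.ofReal_mul a0.le]; ring
    _ ≤ ENNReal.ofReal c ^ 2 *
        (∫⁻ x, ENNReal.ofReal ((min (h x) (ENNReal.ofReal c)).toReal / c)) ^ 2 := by gcongr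
    _ = (∫⁻ x, min (h x) (ENNReal.ofReal c)) ^ 2 := by
        rw [← mul_pow, ← ex _ c c0 (by fun_prop) mt]
    _ ≤ _ := by
        gcongr
        exact min_le_left _ _

lemma pl1 {f g h : ℝ → ENNReal} (hf : Measurable f) (hg : Measurable g) (hh : Measurable h)
    (hfg : ∀ x y, f x * g y ≤ h ((x + y) * (1/2)) ^ 2) :
    (∫⁻ x, f x) * ∫⁻ x, g x ≤ (∫⁻ x, h x) ^ 2 := by
  have key : ∀ F : ℝ → ENNReal, Measurable F →
      ∫⁻ x, F x = ⨆ k : ℕ, ∫⁻ x, min (F x) k := by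
    intro F hF
    rw [← lintegral_iSup (f := fun (k : ℕ) x => min (F x) (k : ENNReal)) (fun k => by fun_prop)
      (fun i j hij x => min_le_min_left _ (by exact_mod_cast hij))]
    refine lintegral_congr fun x => ?_
    show F x = ⨆ k : ℕ, F x ⊓ (k : ENNReal)
    rw [← inf_iSup_eq, ENNReal.iSup_natCast, inf_top_eq]
  rw [key f hf, key g hg]
  simp only [ENNReal.iSup_mul, ENNReal.mul_iSup]
  refine iSup₂_le fun i j => ?_
  refine le_trans (b := (∫⁻ x, min (f x) ((max i j : ℕ) : ENNReal)) *
    ∫⁻ x, min (g x) ((max i j : ℕ) : ENNReal)) ?_ ?_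
  · exact mul_le_mul' (lintegral_mono fun x => min_le_min_left _ (by simp))
      (lintegral_mono fun x => min_le_min_left _ (by simp))
  · refine pl1_bdd (by fun_prop) (by fun_prop) hh (max i j : ℕ) (fun x => ?_)
      (fun x => ?_) (fun x y => le_trans ?_ (hfg x y))
    · exact_mod_cast min_le_right _ _
    · exact_mod_cast min_le_right _ _
    · exact mul_le_mul' (min_le_left _ _) (min_le_left _ _)

lemma pl : ∀ (n : ℕ) {f g h : (Fin n → ℝ) → ENNReal}, Measurable f → Measurable g →
    Measurable h → (∀ x y, f x * g y ≤ h ((1/2 : ℝ) • (x + y)) ^ 2) →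
    (∫⁻ x, f x) * ∫⁻ x, g x ≤ (∫⁻ x, h x) ^ 2 := by
  intro n
  induction n with
  | zero =>
    intro f g h hf hg hh hfg
    have : ∀ F : (Fin 0 → ℝ) → ENNReal, ∫⁻ x, F x = F 0 := by
      intro F
      rw [Measure.volume_pi_eq_dirac 0, lintegral_dirac]
    rw [this, this, this]
    simpa using hfg 0 0
  | succ n ih =>
    intro f g h hf hg hh hfg
    have mp := volume_preserving_piFinSuccAbove (fun _ : Fin (n+1) => ℝ) 0
    set e := MeasurableEquiv.piFinSuccAbove (fun _ : Fin (n+1) => ℝ) 0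
    have ecomb : ∀ (s t : ℝ) (x y : Fin n → ℝ),
        (1/2 : ℝ) • (e.symm (s, x) + e.symm (t, y)) =
          e.symm ((s + t) * (1/2), (1/2 : ℝ) • (x + y)) := by
      intro s t x y
      ext i
      refine Fin.cases ?_ (fun i => ?_) i
      · simp [e, MeasurableEquiv.piFinSuccAbove, mul_comm]
      · simp [e, MeasurableEquiv.piFinSuccAbove, mul_comm]
        try ring
    have ex : ∀ F : (Fin (n+1) → ℝ) → ENNReal, Measurable F →
        ∫⁻ x, F x = ∫⁻ s : ℝ, ∫⁻ x : Fin n → ℝ, F (e.symm (s, x)) := by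
      intro F hF
      rw [← mp.symm.lintegral_comp hF]
      exact lintegral_prod _ (by fun_prop)
    have me : ∀ F : (Fin (n+1) → ℝ) → ENNReal, Measurable F →
        Measurable fun s : ℝ => ∫⁻ x : Fin n → ℝ, F (e.symm (s, x)) := by
      intro F hF
      apply Measurable.lintegral_prod_right'
        (f := fun p : ℝ × (Fin n → ℝ) => F (e.symm p)) (by fun_prop)
    rw [ex f hf, ex g hg, ex h hh]
    apply pl1 (me f hf) (me g hg) (me h hh)
    intro s t
    apply ih (by fun_prop) (by fun_prop) (by fun_prop)
    intro x y
    rw [← ecomb]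
    exact hfg _ _

/-- Multiplicative Brunn–Minkowski. -/
lemma bm {n : ℕ} {A B C : Set (Fin n → ℝ)} (hA : MeasurableSet A) (hB : MeasurableSet B)
    (hC : MeasurableSet C) (h : ∀ x ∈ A, ∀ y ∈ B, (1/2 : ℝ) • (x + y) ∈ C) :
    volume A * volume B ≤ volume C ^ 2 := by
  have := pl n (f := A.indicator 1) (g := B.indicator 1) (h := C.indicator 1)
    (measurable_one.indicator hA) (measurable_one.indicator hB) (measurable_one.indicator hC)
    (fun x y => by
      by_cases hx : x ∈ A
      · by_cases hy : y ∈ B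
        · have := h x hx y hy
          simp only [Set.indicator_of_mem hx, Set.indicator_of_mem hy,
            Set.indicator_of_mem this]
          simp
        · simp [hy]
      · simp [hx])
  simpa [lintegral_indicator_one, hA, hB, hC] using this

end AFx


namespace AFx

lemma spec {ι : Type*} [Fintype ι] [DecidableEq ι] (M : Matrix ι ι ℝ) (hM : M.IsHermitian) :
    ∃ (b : ι → ι → ℝ) (l : ι → ℝ), (∀ i, Matrix.mulVec M (b i) = l i • b i) ∧
      (∀ i, b i ⬝ᵥ b i = 1) ∧ ∀ x y : ι → ℝ, ∑ i, (x ⬝ᵥ b i) * (b i ⬝ᵥ y) = x ⬝ᵥ y := by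
  have hin : ∀ x y : EuclideanSpace ℝ ι, inner ℝ x y = x.ofLp ⬝ᵥ y.ofLp := by
    intro x y
    rw [EuclideanSpace.inner_eq_star_dotProduct, dotProduct_comm]; simp
  refine ⟨fun i => (hM.eigenvectorBasis i).ofLp, hM.eigenvalues, fun i => ?_, fun i => ?_, ?_⟩
  · exact hM.mulVec_eigenvectorBasis i
  · rw [← hin, real_inner_self_eq_norm_sq, hM.eigenvectorBasis.orthonormal.1 i]; norm_num
  · intro x y
    have := hM.eigenvectorBasis.sum_inner_mul_inner (WithLp.toLp 2 x) (WithLp.toLp 2 y)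
    simpa [hin] using this

lemma pf {ι : Type*} [Fintype ι] [DecidableEq ι] (A : ι → ι → ℝ) (hA : ∀ j k, A j k = A k j)
    (v p : ι → ℝ) (hv : ∀ j, 0 < v j) (hp : ∀ j, 0 < p j) (hAv : ∀ j, ∑ k, A j k * v k = p j)
    (hA0 : ∀ j k, j ≠ k → 0 ≤ A j k)
    (hconn : ∀ T : Set ι, ∀ j k, j ∈ T → k ∉ T → ∃ j ∈ T, ∃ k ∉ T, 0 < A j k)
    (hq : ∀ x : ι → ℝ, ∑ j, x j * ∑ k, A j k * x k ≤ ∑ j, v j * (∑ k, A j k * x k) ^ 2 / p j)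
    (x : ι → ℝ) (hx : ∑ j, x j * p j = 0) : ∑ j, x j * ∑ k, A j k * x k ≤ 0 := by
  set d : ι → ℝ := fun j => Real.sqrt (v j / p j) with hd
  have hd0 : ∀ j, 0 < d j := fun j => Real.sqrt_pos.2 (div_pos (hv j) (hp j))
  have hd2 : ∀ j, d j ^ 2 = v j / p j := fun j => Real.sq_sqrt (div_pos (hv j) (hp j)).le
  set M : Matrix ι ι ℝ := Matrix.of fun j k => d j * A j k * d k with hMd
  have hM : M.IsHermitian := by
    ext j k
    simp [M, hA k j]; ring
  have hMv : ∀ y j, Matrix.mulVec M y j = d j * ∑ k, A j k * (d k * y k) := by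
    intro y j
    simp only [M, Matrix.mulVec, dotProduct, Matrix.of_apply, mul_sum]
    exact sum_congr rfl fun k _ => by ring
  obtain ⟨b, l, hb, hb1, hbs⟩ := spec M hM
  -- form
  have hform : ∀ y : ι → ℝ, y ⬝ᵥ Matrix.mulVec M y =
      ∑ j, (d j * y j) * ∑ k, A j k * (d k * y k) := by
    intro y
    simp only [dotProduct, hMv]
    exact sum_congr rfl fun k _ => by ring
  have hle2 : ∀ i, l i ≤ l i ^ 2 := by
    intro i
    have h1 := hform (b i)
    have h2 := hq (fun j => d j * b i j)
    rw [← h1, hb] at h2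
    have h3 : ∀ j, v j * (∑ k, A j k * (d k * b i k)) ^ 2 / p j = l i ^ 2 * (b i j * b i j) := by
      intro j
      have h4 := hMv (b i) j
      rw [hb] at h4
      simp only [Pi.smul_apply, smul_eq_mul] at h4
      calc _ = (v j / p j) * (∑ k, A j k * (d k * b i k)) ^ 2 := by ring
        _ = (l i * b i j) ^ 2 := by rw [← hd2, h4]; ring
        _ = _ := by ring
    simp only [h3] at h2
    rw [← mul_sum] at h2
    have h5 := hb1 i
    simp only [dotProduct] at h5
    rw [h5, mul_one] at h2
    simpa [hb1 i] using h2
  have hdiff : ∀ y : ι → ℝ, ∑ j, y j ^ 2 * p j / v j - ∑ j, y j * ∑ k, A j k * y k =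
      (∑ j, ∑ k, A j k * v j * v k * (y j / v j - y k / v k) ^ 2) / 2 := by
    intro y
    have e1 : ∑ j, y j ^ 2 * p j / v j = ∑ j, ∑ k, A j k * v j * v k * (y j / v j) ^ 2 := by
      refine sum_congr rfl fun j _ => ?_
      rw [← hAv, mul_sum, sum_div]
      refine sum_congr rfl fun k _ => ?_
      have := (hv j).ne'
      field_simp
    have e2 : ∑ j, y j ^ 2 * p j / v j = ∑ j, ∑ k, A j k * v j * v k * (y k / v k) ^ 2 := by
      rw [e1, sum_comm]
      refine sum_congr rfl fun j _ => sum_congr rfl fun k _ => ?_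
      rw [hA]; ring
    have e3 : ∑ j, y j * ∑ k, A j k * y k =
        ∑ j, ∑ k, A j k * v j * v k * ((y j / v j) * (y k / v k)) := by
      refine sum_congr rfl fun j _ => ?_
      rw [mul_sum]
      refine sum_congr rfl fun k _ => ?_
      have := (hv j).ne'
      have := (hv k).ne'
      field_simp
    have e4 : (∑ j, ∑ k, A j k * v j * v k * (y j / v j - y k / v k) ^ 2) =
      ∑ j, ∑ k, A j k * v j * v k * (y j / v j) ^ 2 + ∑ j, ∑ k, A j k * v j * v k * (y k / v k) ^ 2
        - 2 * ∑ j, ∑ k, A j k * v j * v k * ((y j / v j) * (y k / v k)) := by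
      simp only [mul_sum, ← sum_add_distrib, ← sum_sub_distrib]
      exact sum_congr rfl fun j _ => sum_congr rfl fun k _ => by ring
    rw [e4, ← e1, ← e2, e3]; ring
  have hterm : ∀ (y : ι → ℝ) j k, 0 ≤ A j k * v j * v k * (y j / v j - y k / v k) ^ 2 := by
    intro y j k
    by_cases h : j = k
    · subst h; simp
    · have := hA0 j k h
      have := hv j
      have := hv k
      positivity
  have hsum1 : ∀ i, ∑ j, (d j * b i j) ^ 2 * p j / v j = 1 := by
    intro i
    rw [← hb1 i]
    refine sum_congr rfl fun j _ => ?_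
    rw [mul_pow, hd2]
    have := (hv j).ne'
    have := (hp j).ne'
    field_simp
  have hli : ∀ i, l i = ∑ j, (d j * b i j) * ∑ k, A j k * (d k * b i k) := by
    intro i
    rw [← hform, hb]; simp [hb1]
  have hle1 : ∀ i, l i ≤ 1 := by
    intro i
    have h1 := hdiff (fun j => d j * b i j)
    rw [hsum1, ← hli] at h1
    have : 0 ≤ ∑ j, ∑ k, A j k * v j * v k * (d j * b i j / v j - d k * b i k / v k) ^ 2 :=
      sum_nonneg fun j _ => sum_nonneg fun k _ => hterm (fun j => d j * b i j) j k
    linarith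
  have heq1 : ∀ i, l i = 1 → ∀ j k, d j * b i j / v j = d k * b i k / v k := by
    intro i hi j k
    by_contra hne
    obtain ⟨j', hj', k', hk', hpos⟩ := hconn {m | d m * b i m / v m = d j * b i j / v j} j k rfl
      (fun h => hne h.symm)
    have h1 := hdiff (fun j => d j * b i j)
    rw [hsum1, ← hli, hi] at h1
    have h2 : ∑ j, ∑ k, A j k * v j * v k * (d j * b i j / v j - d k * b i k / v k) ^ 2 = 0 := by
      linarith
    rw [sum_eq_zero_iff_of_nonneg fun j _ => sum_nonneg fun k _ =>
      hterm (fun j => d j * b i j) j k] at h2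
    have h3 := h2 j' (mem_univ _)
    rw [sum_eq_zero_iff_of_nonneg fun k _ => hterm (fun j => d j * b i j) j' k] at h3
    have h4 := h3 k' (mem_univ _)
    have h5 : d j' * b i j' / v j' - d k' * b i k' / v k' ≠ 0 := by
      intro h
      apply hk'
      have : d j' * b i j' / v j' = d j * b i j / v j := hj'
      show d k' * b i k' / v k' = d j * b i j / v j
      linarith
    have := hv j'
    have := hv k'
    have : 0 < A j' k' * v j' * v k' * (d j' * b i j' / v j' - d k' * b i k' / v k') ^ 2 := by
      positivity
    linarith
  -- conclude
  have h1 := hform (fun j => x j / d j)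
  have h2 : ∀ j, d j * (x j / d j) = x j := fun j => mul_div_cancel₀ _ (hd0 j).ne'
  simp only [h2] at h1
  rw [← h1, ← hbs]
  apply sum_nonpos
  intro i _
  have h3 : b i ⬝ᵥ Matrix.mulVec M (fun j => x j / d j) = l i * ((fun j => x j / d j) ⬝ᵥ b i) := by
    rw [Matrix.dotProduct_mulVec, ← Matrix.mulVec_transpose]
    have : M.transpose = M := by
      ext j k
      simp [M, hA k j]; ring
    rw [this, hb, smul_dotProduct, dotProduct_comm]; rfl
  rw [h3]
  by_cases h0 : l i ≤ 0
  · nlinarith [sq_nonneg ((fun j => x j / d j) ⬝ᵥ b i)]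
  have hl1 : l i = 1 := le_antisymm (hle1 i) (by nlinarith [hle2 i])
  have : (fun j => x j / d j) ⬝ᵥ b i = 0 := by
    rcases isEmpty_or_nonempty ι with _ | ⟨⟨j0⟩⟩
    · simp [dotProduct]
    have h4 : ∀ j, x j / d j * b i j = x j * p j * (d j0 * b i j0 / v j0) := by
      intro j
      rw [← heq1 i hl1 j j0]
      have := (hd0 j).ne'
      have := (hv j).ne'
      have := (hp j).ne'
      have h6 : p j * d j ^ 2 = v j := by rw [hd2]; field_simp
      field_simp
      rw [← h6]; ring
    simp only [dotProduct, h4, ← sum_mul, hx, zero_mul]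
  rw [this]; simp

end AFx


namespace AFx

/-- multiset of coordinate vectors -/
def eM {J : Type*} [DecidableEq J] (S : Finset J) : Multiset (J → ℝ) :=
  S.val.map fun j => Pi.single j (1 : ℝ)

lemma eM_insert {J : Type*} [DecidableEq J] {S : Finset J} {j : J} (h : j ∉ S) :
    eM (insert j S) = Pi.single j (1 : ℝ) ::ₘ eM S := by
  simp [eM, Finset.insert_val_of_notMem h]

lemma card_eM {J : Type*} [DecidableEq J] (S : Finset J) : (eM S).card = S.card := by
  simp [eM]

/-- abstract data for the algebraic part of Alexandrov–Fenchel -/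
structure AF (n : ℕ) (J : Type*) [Fintype J] [DecidableEq J] where
  D : Finset J → Prop
  C : Set (J → ℝ)
  U : Submodule ℝ (J → ℝ)
  Q : Multiset (J → ℝ) → ℝ
  add : ∀ s x y, Multiset.card s + 1 = n → Q ((x + y) ::ₘ s) = Q (x ::ₘ s) + Q (y ::ₘ s)
  smul : ∀ s (c : ℝ) x, Multiset.card s + 1 = n → Q ((c • x) ::ₘ s) = c * Q (x ::ₘ s)
  inv : ∀ s, ∀ x ∈ U, Multiset.card s + 1 = n → Q (x ::ₘ s) = 0
  down : ∀ S T, D S → T ⊆ S → D T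
  van : ∀ S s, ¬ D S → Finset.card S + Multiset.card s = n → Q (eM S + s) = 0
  pos : ∀ S, D S → S.card = n → 0 < Q (eM S)
  norm : ∀ h ∈ C, ∀ S, D S → ∃ u ∈ U, (∀ j ∈ S, (h - u) j = 0) ∧ ∀ j ∉ S, 0 < (h - u) j
  intp : ∀ x S, D S → ∃ u ∈ U, ∀ j ∈ S, (x - u) j = 0
  ext : ∀ S, D S → S.card < n → ∃ j ∉ S, D (insert j S)
  conn : ∀ S, D S → S.card + 2 ≤ n → ∀ T : Set J, ∀ j ∈ T, ∀ k ∉ T, j ∉ S → k ∉ S →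
    D (insert j S) → D (insert k S) → ∃ j ∈ T, ∃ k ∉ T, j ∉ S ∧ k ∉ S ∧ D (insert j (insert k S))
  base : ∀ S, D S → S.card + 2 = n → ∀ w ∈ C, ∀ x, Q (x ::ₘ x ::ₘ eM S) * Q (w ::ₘ w ::ₘ eM S) ≤
    Q (x ::ₘ w ::ₘ eM S) ^ 2

namespace AF

variable {n : ℕ} {J : Type*} [Fintype J] [DecidableEq J] (F : AF n J)

open Classical in
/-- link -/
noncomputable def link (S : Finset J) : Finset J := univ.filter fun j => j ∉ S ∧ F.D (insert j S)

lemma mem_link {S : Finset J} {j : J} : j ∈ F.link S ↔ j ∉ S ∧ F.D (insert j S) := by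
  simp [link]

lemma zero (s) (hs : Multiset.card s + 1 = n) : F.Q (0 ::ₘ s) = 0 := by
  have := F.smul s 0 0 hs
  simpa using this

lemma sum (s) (hs : Multiset.card s + 1 = n) {ι : Type*} (t : Finset ι) (x : ι → J → ℝ) :
    F.Q ((∑ i ∈ t, x i) ::ₘ s) = ∑ i ∈ t, F.Q (x i ::ₘ s) := by
  classical
  induction t using Finset.induction_on with
  | empty => simp [F.zero s hs]
  | insert a t ha ih => rw [sum_insert ha, sum_insert ha, F.add _ _ _ hs, ih]

lemma sub (s) (hs : Multiset.card s + 1 = n) (x y) :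
    F.Q ((x - y) ::ₘ s) = F.Q (x ::ₘ s) - F.Q (y ::ₘ s) := by
  have := F.add s (x - y) y hs
  rw [sub_add_cancel] at this
  linarith

lemma subU (s) (hs : Multiset.card s + 1 = n) (x u) (hu : u ∈ F.U) :
    F.Q ((x - u) ::ₘ s) = F.Q (x ::ₘ s) := by
  rw [F.sub s hs, F.inv s u hu hs, sub_zero]

lemma expand0 {S : Finset J} {s} (hs : S.card + Multiset.card s + 1 = n) (y : J → ℝ)
    (hy : ∀ j ∈ S, y j = 0) :
    F.Q (y ::ₘ (s + eM S)) = ∑ j ∈ F.link S, y j * F.Q (s + eM (insert j S)) := by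
  have hc : Multiset.card (s + eM S) + 1 = n := by rw [Multiset.card_add, card_eM]; omega
  have h1 : y = ∑ j, y j • (Pi.single j (1 : ℝ) : J → ℝ) := by
    ext k
    simp [Finset.sum_apply, Pi.single_apply]
  conv_lhs => rw [h1]
  rw [F.sum _ hc, ← sum_subset (subset_univ (F.link S))]
  · refine sum_congr rfl fun j hj => ?_
    rw [F.smul _ _ _ hc, eM_insert (F.mem_link.1 hj).1, Multiset.add_cons]
  · intro j _ hj
    rw [F.smul _ _ _ hc]
    by_cases hjS : j ∈ S
    · rw [hy j hjS, zero_mul]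
    · have : ¬ F.D (insert j S) := fun h => hj (F.mem_link.2 ⟨hjS, h⟩)
      have h2 := F.van (insert j S) s this (by rw [card_insert_of_notMem hjS]; omega)
      rw [eM_insert hjS, Multiset.cons_add, add_comm] at h2
      rw [h2, mul_zero]

lemma posC : ∀ (s : Multiset (J → ℝ)) (S : Finset J), F.D S → S.card + Multiset.card s = n →
    (∀ v ∈ s, v ∈ F.C) → 0 < F.Q (s + eM S) := by
  intro s
  induction s using Multiset.induction_on with
  | empty => intro S hS hc _; simpa using F.pos S hS (by simpa using hc)
  | cons v s ih =>
    intro S hS hc hv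
    rw [Multiset.card_cons] at hc
    obtain ⟨u, hu, h0, h1⟩ := F.norm v (hv v (by simp)) S hS
    rw [Multiset.cons_add, ← F.subU _ (by rw [Multiset.card_add, card_eM]; omega) v u hu,
      F.expand0 (by omega) _ h0]
    obtain ⟨j, hj, hjD⟩ := F.ext S hS (by omega)
    apply sum_pos
    · intro k hk
      have hk' := F.mem_link.1 hk
      exact mul_pos (h1 k hk'.1) (ih _ hk'.2 (by rw [card_insert_of_notMem hk'.1]; omega)
        fun w hw => hv w (by simp [hw]))
    · exact ⟨j, F.mem_link.2 ⟨hj, hjD⟩⟩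

lemma rcs {Bxx Bxv Bvv : ℝ} (hv : 0 < Bvv) (h : Bxx - 2 * (Bxv / Bvv) * Bxv +
    (Bxv / Bvv) ^ 2 * Bvv ≤ 0) : Bxx * Bvv ≤ Bxv ^ 2 := by
  have : Bxx - 2 * (Bxv / Bvv) * Bxv + (Bxv / Bvv) ^ 2 * Bvv = (Bxx * Bvv - Bxv ^ 2) / Bvv := by
    field_simp; ring
  rw [this] at h
  have := (div_le_iff₀ hv).1 h
  linarith

/-- bilinear expansion -/
lemma bil (s) (hs : Multiset.card s + 2 = n) (x v : J → ℝ) (c : ℝ) :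
    F.Q ((x - c • v) ::ₘ (x - c • v) ::ₘ s) =
      F.Q (x ::ₘ x ::ₘ s) - 2 * c * F.Q (x ::ₘ v ::ₘ s) + c ^ 2 * F.Q (v ::ₘ v ::ₘ s) := by
  have hc : ∀ z : J → ℝ, Multiset.card (z ::ₘ s) + 1 = n := by
    intro z; rw [Multiset.card_cons]; omega
  rw [F.sub _ (hc _), F.smul _ _ _ (hc _), Multiset.cons_swap x, Multiset.cons_swap v,
    F.sub _ (hc _), F.smul _ _ _ (hc _), F.sub _ (hc _), F.smul _ _ _ (hc _),
    Multiset.cons_swap v x]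
  ring

theorem main : ∀ (s : Multiset (J → ℝ)) (S : Finset J), F.D S →
    S.card + Multiset.card s + 2 = n → (∀ v ∈ s, v ∈ F.C) → ∀ w ∈ F.C, ∀ x,
    F.Q (x ::ₘ x ::ₘ (s + eM S)) * F.Q (w ::ₘ w ::ₘ (s + eM S)) ≤
      F.Q (x ::ₘ w ::ₘ (s + eM S)) ^ 2 := by
  intro s
  induction s using Multiset.induction_on with
  | empty =>
    intro S hS hc _ w hw x
    simpa using F.base S hS (by simpa using hc) w hw x
  | cons v s ih =>
    intro S hS hc hvC w hw x
    rw [Multiset.card_cons] at hc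
    have hv : v ∈ F.C := hvC v (by simp)
    have hsC : ∀ v ∈ s, v ∈ F.C := fun w hw => hvC w (by simp [hw])
    obtain ⟨u, hu, y0, y1⟩ := F.norm v hv S hS
    set y := v - u with hy
    have hcS : Multiset.card (s + eM S) + 3 = n := by rw [Multiset.card_add, card_eM]; omega
    have cardj : ∀ j ∈ F.link S, (insert j S).card = S.card + 1 := fun j hj =>
      card_insert_of_notMem (F.mem_link.1 hj).1
    -- matrix
    let ι := {j // j ∈ F.link S}
    let A : ι → ι → ℝ := fun j k =>
      F.Q (Pi.single j.1 1 ::ₘ Pi.single k.1 1 ::ₘ v ::ₘ (s + eM S))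
    let p : ι → ℝ := fun j => F.Q (v ::ₘ v ::ₘ (s + eM (insert j.1 S)))
    -- expansion
    have expx : ∀ z t : J → ℝ, (∀ j ∈ S, z j = 0) →
        F.Q (z ::ₘ t ::ₘ v ::ₘ (s + eM S)) =
          ∑ j : ι, z j.1 * F.Q (t ::ₘ v ::ₘ (s + eM (insert j.1 S))) := by
      intro z t hz
      have := F.expand0 (S := S) (s := t ::ₘ v ::ₘ s)
        (by simp only [Multiset.card_cons]; omega) z hz
      simp only [Multiset.cons_add] at this
      rw [this]
      exact (Finset.sum_coe_sort (F.link S)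
        (fun j => z j * F.Q (t ::ₘ v ::ₘ (s + eM (insert j S))))).symm
    have expA : ∀ z : J → ℝ, (∀ j ∈ S, z j = 0) → ∀ j : ι,
        F.Q (z ::ₘ v ::ₘ (s + eM (insert j.1 S))) = ∑ k : ι, A j k * z k.1 := by
      intro z hz j
      have hj := (F.mem_link.1 j.2).1
      have := expx z (Pi.single j.1 1) hz
      rw [eM_insert hj, Multiset.add_cons, Multiset.cons_swap v, Multiset.cons_swap z,
        Multiset.cons_swap _ z, this]
      refine sum_congr rfl fun k _ => ?_
      have hk := (F.mem_link.1 k.2).1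
      simp only [A]
      rw [eM_insert hk, Multiset.add_cons, Multiset.cons_swap v, mul_comm]
    have pval : ∀ j : ι, ∑ k : ι, A j k * y k.1 = p j := by
      intro j
      rw [← expA y y0 j]
      refine F.subU _ ?_ v u hu
      simp only [Multiset.card_cons, Multiset.card_add, card_eM, cardj j.1 j.2]
      omega
    have ppos : ∀ j : ι, 0 < p j := by
      intro j
      have := F.posC (v ::ₘ v ::ₘ s) (insert j.1 S) (F.mem_link.1 j.2).2
        (by simp only [Multiset.card_cons, cardj j.1 j.2]; omega)
        (by
            intro w hw; simp only [Multiset.mem_cons] at hw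
            rcases hw with rfl | rfl | hw
            exacts [hv, hv, hsC _ hw])
      simpa [p] using this
    have Aval : ∀ j k : ι, j ≠ k →
        A j k = F.Q ((v ::ₘ s) + eM (insert j.1 (insert k.1 S))) := by
      intro j k hjk
      have hj := (F.mem_link.1 j.2).1
      have hk := (F.mem_link.1 k.2).1
      have hjk' : j.1 ≠ k.1 := fun h => hjk (Subtype.ext h)
      rw [eM_insert (by simp [hjk', hj]), eM_insert hk, Multiset.add_cons, Multiset.add_cons,
        Multiset.cons_add]
    have Acard : ∀ j k : ι, j ≠ k → (insert j.1 (insert k.1 S)).card = S.card + 2 := by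
      intro j k hjk
      have hj := (F.mem_link.1 j.2).1
      have hk := (F.mem_link.1 k.2).1
      have hjk' : j.1 ≠ k.1 := fun h => hjk (Subtype.ext h)
      rw [card_insert_of_notMem (by simp [hjk', hj]), card_insert_of_notMem hk]
    have Apos : ∀ j k : ι, j ≠ k → F.D (insert j.1 (insert k.1 S)) → 0 < A j k := by
      intro j k hjk hD
      rw [Aval j k hjk]
      exact F.posC _ _ hD (by rw [Acard j k hjk, Multiset.card_cons]; omega) hvC
    have A0 : ∀ j k : ι, j ≠ k → 0 ≤ A j k := by
      intro j k hjk
      by_cases hD : F.D (insert j.1 (insert k.1 S))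
      · exact (Apos j k hjk hD).le
      · rw [Aval j k hjk, add_comm, F.van _ _ hD]
        rw [Acard j k hjk, Multiset.card_cons]; omega
    have Asymm : ∀ j k, A j k = A k j := fun j k => by simp only [A]; rw [Multiset.cons_swap]
    have hconn : ∀ T : Set ι, ∀ j k, j ∈ T → k ∉ T → ∃ j ∈ T, ∃ k ∉ T, 0 < A j k := by
      intro T j k hj hk
      obtain ⟨j', hj', k', hk', h1, h2, h3⟩ := F.conn S hS (by omega) (Subtype.val '' T) j.1
        ⟨j, hj, rfl⟩ k.1 (by rintro ⟨k2, h, e⟩; exact hk (Subtype.ext e ▸ h))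
        (F.mem_link.1 j.2).1 (F.mem_link.1 k.2).1 (F.mem_link.1 j.2).2 (F.mem_link.1 k.2).2
      obtain ⟨j'', hj'', rfl⟩ := hj'
      have hkl : k' ∈ F.link S := F.mem_link.2 ⟨h2, F.down _ _ h3 (subset_insert _ _)⟩
      have hkT : (⟨k', hkl⟩ : ι) ∉ T := fun h => hk' ⟨_, h, rfl⟩
      refine ⟨j'', hj'', ⟨k', hkl⟩, hkT, Apos _ _ ?_ h3⟩
      rintro rfl
      exact hkT hj''
    have Bxx : ∀ z : J → ℝ, (∀ j ∈ S, z j = 0) → F.Q (z ::ₘ z ::ₘ v ::ₘ (s + eM S)) =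
        ∑ j : ι, z j.1 * ∑ k : ι, A j k * z k.1 := by
      intro z hz
      rw [expx z z hz]
      exact sum_congr rfl fun j _ => by rw [expA z hz]
    have hq : ∀ z : ι → ℝ, ∑ j, z j * ∑ k, A j k * z k ≤
        ∑ j : ι, y j.1 * (∑ k, A j k * z k) ^ 2 / p j := by
      intro z'
      let z : J → ℝ := fun j => if h : j ∈ F.link S then z' ⟨j, h⟩ else 0
      have hz : ∀ j ∈ S, z j = 0 := by
        intro j hj
        have : j ∉ F.link S := fun h => (F.mem_link.1 h).1 hj
        simp [z, this]
      have hzz : ∀ j : ι, z j.1 = z' j := by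
        intro j; simp [z]
      have h1 := Bxx z hz
      have h2 : F.Q (z ::ₘ z ::ₘ v ::ₘ (s + eM S)) =
          ∑ j : ι, y j.1 * F.Q (z ::ₘ z ::ₘ (s + eM (insert j.1 S))) := by
        have := F.expand0 (S := S) (s := z ::ₘ z ::ₘ s)
          (by simp only [Multiset.card_cons]; omega) y y0
        simp only [Multiset.cons_add] at this
        rw [F.subU _ (by simp only [Multiset.card_cons, Multiset.card_add, card_eM]; omega)
          v u hu] at this
        rw [Multiset.cons_swap z v, Multiset.cons_swap z v, this]
        exact (Finset.sum_coe_sort (F.link S)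
          (fun j => y j * F.Q (z ::ₘ z ::ₘ (s + eM (insert j S))))).symm
      simp only [← hzz]
      rw [← h1, h2]
      refine sum_le_sum fun j _ => ?_
      rw [mul_div_assoc]
      have hj := F.mem_link.1 j.2
      refine mul_le_mul_of_nonneg_left ?_ (y1 j.1 hj.1).le
      rw [le_div_iff₀ (ppos j), ← expA z hz]
      exact ih (insert j.1 S) hj.2 (by rw [cardj j.1 j.2]; omega) hsC v hv z
    have hcc : ∀ a : J → ℝ, Multiset.card (a ::ₘ v ::ₘ (s + eM S)) + 1 = n := by
      intro a; rw [Multiset.card_cons, Multiset.card_cons]; omega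
    have hneg : ∀ z : J → ℝ, F.Q (z ::ₘ v ::ₘ v ::ₘ (s + eM S)) = 0 →
        F.Q (z ::ₘ z ::ₘ v ::ₘ (s + eM S)) ≤ 0 := by
      intro z' hz'
      obtain ⟨u', hu', hz⟩ := F.intp z' S hS
      have e1 : F.Q ((z' - u') ::ₘ (z' - u') ::ₘ v ::ₘ (s + eM S)) =
          F.Q (z' ::ₘ z' ::ₘ v ::ₘ (s + eM S)) := by
        rw [F.subU _ (hcc _) z' u' hu', Multiset.cons_swap, F.subU _ (hcc _) z' u' hu']
      rw [← e1, Bxx _ hz]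
      apply pf A Asymm (fun j => y j.1) p (fun j => y1 _ (F.mem_link.1 j.2).1) ppos pval A0 hconn
        hq
      rw [← F.subU _ (hcc v) z' u' hu', expx _ _ hz] at hz'
      exact hz'
    have Bpos : ∀ a ∈ F.C, ∀ b ∈ F.C, 0 < F.Q (a ::ₘ b ::ₘ v ::ₘ (s + eM S)) := by
      intro a ha b hb
      have := F.posC (a ::ₘ b ::ₘ v ::ₘ s) S hS
        (by simp only [Multiset.card_cons]; omega)
        (by
            intro w hw; simp only [Multiset.mem_cons] at hw
            rcases hw with rfl | rfl | rfl | hw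
            exacts [ha, hb, hv, hsC _ hw])
      simpa using this
    have hs2 : Multiset.card (v ::ₘ (s + eM S)) + 2 = n := by
      rw [Multiset.card_cons]; omega
    rw [Multiset.cons_add]
    -- B(z,z) ≤ 0 when B(z,w) = 0
    set R := v ::ₘ (s + eM S) with hR
    have h1 : ∀ z, F.Q (z ::ₘ z ::ₘ R) * F.Q (v ::ₘ v ::ₘ R) ≤ F.Q (z ::ₘ v ::ₘ R) ^ 2 := by
      intro z
      apply rcs (Bpos v hv v hv)
      rw [← F.bil R hs2]
      apply hneg
      rw [F.sub _ (hcc v), F.smul _ _ _ (hcc v), div_mul_cancel₀ _ (Bpos v hv v hv).ne', sub_self]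
    apply rcs (Bpos w hw w hw)
    rw [← F.bil R hs2]
    set z := x - (F.Q (x ::ₘ w ::ₘ R) / F.Q (w ::ₘ w ::ₘ R)) • w with hz
    have hzw : F.Q (z ::ₘ w ::ₘ R) = 0 := by
      rw [hz, F.sub _ (hcc w), F.smul _ _ _ (hcc w), div_mul_cancel₀ _ (Bpos w hw w hw).ne',
        sub_self]
    by_contra hcon
    push Not at hcon
    -- t = z - c w with B(t,v) = 0
    set c := F.Q (z ::ₘ v ::ₘ R) / F.Q (w ::ₘ v ::ₘ R) with hcdef
    have h2 : F.Q ((z - c • w) ::ₘ v ::ₘ R) = 0 := by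
      rw [F.sub _ (hcc v), F.smul _ _ _ (hcc v), div_mul_cancel₀ _ (Bpos w hw v hv).ne', sub_self]
    have h3 := hneg _ h2
    rw [F.bil R hs2, hzw] at h3
    nlinarith [sq_nonneg c, Bpos w hw w hw, mul_nonneg (sq_nonneg c) (Bpos w hw w hw).le]

end AF

end AFx


namespace AFx

/-- simplicial fan data -/
structure Fan (n : ℕ) (J : Type*) [Fintype J] [DecidableEq J] where
  u : J → (Fin n → ℝ) →ₗ[ℝ] ℝ
  B : Finset (Finset J)
  X : Finset J → (J → ℝ) →ₗ[ℝ] (Fin n → ℝ)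
  tight : ∀ S ∈ B, ∀ h, ∀ i ∈ S, u i (X S h) = h i
  inj : ∀ S ∈ B, ∀ x, (∀ i ∈ S, u i x = 0) → x = 0
  card : ∀ S ∈ B, S.card = n
  cover : ∀ c : (Fin n → ℝ) →ₗ[ℝ] ℝ, ∃ S ∈ B, ∃ l : J → ℝ, (∀ i, 0 ≤ l i) ∧
    ∀ x, c x = ∑ i ∈ S, l i * u i x
  Cne : ∃ h : J → ℝ, ∀ S ∈ B, ∀ j ∉ S, u j (X S h) < h j

namespace Fan

variable {n : ℕ} {J : Type*} [Fintype J] [DecidableEq J] (F : Fan n J)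

def C : Set (J → ℝ) := {h | ∀ S ∈ F.B, ∀ j ∉ S, F.u j (F.X S h) < h j}
def P (h : J → ℝ) : Set (Fin n → ℝ) := {x | ∀ j, F.u j x ≤ h j}
def U : (Fin n → ℝ) →ₗ[ℝ] (J → ℝ) := LinearMap.pi F.u
def D (T : Finset J) : Prop := ∃ S ∈ F.B, T ⊆ S

@[simp] lemma U_apply (a) (j : J) : F.U a j = F.u j a := rfl

lemma cont (j : J) : Continuous (F.u j) := LinearMap.continuous_of_finiteDimensional _

lemma XU {S} (hS : S ∈ F.B) (a) : F.X S (F.U a) = a := by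
  have := F.inj S hS (F.X S (F.U a) - a) fun i hi => by
    rw [map_sub, F.tight S hS _ i hi]; simp
  exact sub_eq_zero.1 this

lemma Xuniq {S} (hS : S ∈ F.B) {x h} (hx : ∀ i ∈ S, F.u i x = h i) : F.X S h = x := by
  have := F.inj S hS (F.X S h - x) fun i hi => by
    rw [map_sub, F.tight S hS _ i hi, hx i hi, sub_self]
  exact sub_eq_zero.1 this

lemma C_add {h h'} (hh : h ∈ F.C) (hh' : h' ∈ F.C) : h + h' ∈ F.C := by
  intro S hS j hj
  rw [map_add, map_add]
  exact add_lt_add (hh S hS j hj) (hh' S hS j hj)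

lemma C_smul {h} (hh : h ∈ F.C) {t : ℝ} (ht : 0 < t) : t • h ∈ F.C := by
  intro S hS j hj
  rw [map_smul, map_smul]
  exact mul_lt_mul_of_pos_left (hh S hS j hj) ht

lemma C_U {h} (hh : h ∈ F.C) (a) : h + F.U a ∈ F.C := by
  intro S hS j hj
  rw [map_add, map_add, F.XU hS]
  simpa using hh S hS j hj

lemma C_big {h} (hh : h ∈ F.C) (y : J → ℝ) : ∃ N : ℕ, ∀ t : ℝ, N ≤ t → t • h + y ∈ F.C := by
  have : ∀ S ∈ F.B, ∀ j, ∃ N : ℝ, ∀ t : ℝ, N ≤ t → j ∉ S →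
      F.u j (F.X S (t • h + y)) < (t • h + y) j := by
    intro S hS j
    by_cases hj : j ∈ S
    · exact ⟨0, fun t _ h => absurd hj h⟩
    have h1 := hh S hS j hj
    refine ⟨(F.u j (F.X S y) - y j) / (h j - F.u j (F.X S h)) + 1, fun t ht _ => ?_⟩
    have h2 : (F.u j (F.X S y) - y j) / (h j - F.u j (F.X S h)) < t := by linarith
    rw [div_lt_iff₀ (by linarith)] at h2
    simp only [map_add, map_smul, smul_eq_mul, Pi.add_apply, Pi.smul_apply]
    nlinarith
  choose! N hN using this
  obtain ⟨M, hM⟩ := exists_nat_ge (∑ S ∈ F.B, ∑ j, |N S j|)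
  refine ⟨M, fun t ht S hS j hj => hN S hS j t ?_ hj⟩
  refine le_trans ?_ (hM.trans ht)
  refine (le_abs_self _).trans ?_
  refine le_trans (single_le_sum (f := fun j => |N S j|) (fun _ _ => abs_nonneg _) (mem_univ j)) ?_
  exact single_le_sum (f := fun S => ∑ j, |N S j|)
    (fun _ _ => sum_nonneg fun _ _ => abs_nonneg _) hS

lemma X_mem {h} (hh : h ∈ F.C) {S} (hS : S ∈ F.B) : F.X S h ∈ F.P h := by
  intro j
  by_cases hj : j ∈ S
  · exact (F.tight S hS h j hj).le
  · exact (hh S hS j hj).le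

lemma tightD {h} (hh : h ∈ F.C) {x} (hx : x ∈ F.P h) {T : Finset J}
    (hT : ∀ i ∈ T, F.u i x = h i) : F.D T := by
  obtain ⟨S, hS, l, hl, hc⟩ := F.cover (∑ i ∈ T, F.u i)
  refine ⟨S, hS, fun j hj => ?_⟩
  by_contra hjS
  have h1 : ∑ i ∈ S, l i * F.u i x ≤ ∑ i ∈ S, l i * h i :=
    sum_le_sum fun i _ => mul_le_mul_of_nonneg_left (hx i) (hl i)
  have h2 := hc x
  have h3 := hc (F.X S h)
  simp only [LinearMap.sum_apply] at h2 h3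
  have h4 : ∑ i ∈ S, l i * F.u i (F.X S h) = ∑ i ∈ S, l i * h i :=
    sum_congr rfl fun i hi => by rw [F.tight S hS h i hi]
  have h5 : ∑ i ∈ T, F.u i (F.X S h) < ∑ i ∈ T, F.u i x := by
    apply sum_lt_sum
    · intro i hi
      rw [hT i hi]; exact F.X_mem hh hS i
    · exact ⟨j, hj, by rw [hT j hj]; exact hh S hS j hjS⟩
  linarith

lemma bdd (h) : Bornology.IsBounded (F.P h) := by
  have : ∀ c : (Fin n → ℝ) →ₗ[ℝ] ℝ, ∃ M, ∀ x ∈ F.P h, c x ≤ M := by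
    intro c
    obtain ⟨S, hS, l, hl, hc⟩ := F.cover c
    refine ⟨∑ i ∈ S, l i * h i, fun x hx => ?_⟩
    rw [hc]
    exact sum_le_sum fun i _ => mul_le_mul_of_nonneg_left (hx i) (hl i)
  choose M hM using this
  refine (Metric.isBounded_Icc (fun i => - M (-LinearMap.proj i))
    (fun i => M (LinearMap.proj i))).subset fun x hx => ⟨fun i => ?_, fun i => ?_⟩
  · have := hM (-LinearMap.proj i) x hx
    simp at this; linarith
  · exact hM (LinearMap.proj i) x hx

lemma isClosed_P (h) : IsClosed (F.P h) := by
  have : F.P h = ⋂ j, {x | F.u j x ≤ h j} := by ext; simp [P]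
  rw [this]
  exact isClosed_iInter fun j => isClosed_le (F.cont j) continuous_const

lemma convex_P (h) : Convex ℝ (F.P h) := by
  intro x hx y hy a b ha hb hab j
  rw [map_add, map_smul, map_smul]
  calc a • F.u j x + b • F.u j y ≤ a * h j + b * h j :=
        add_le_add (mul_le_mul_of_nonneg_left (hx j) ha) (mul_le_mul_of_nonneg_left (hy j) hb)
    _ = h j := by rw [← add_mul, hab, one_mul]

lemma P_hull {h} : F.P h ⊆ convexHull ℝ ((fun S => F.X S h) '' F.B) := by
  intro x hx
  by_contra hcon
  have hfin : ((fun S => F.X S h) '' (F.B : Set (Finset J))).Finite := F.B.finite_toSet.image _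
  obtain ⟨c, s, h1, h2⟩ := geometric_hahn_banach_closed_point (convex_convexHull ℝ _)
    (hfin.isCompact_convexHull ℝ).isClosed hcon
  obtain ⟨S, hS, l, hl, hc⟩ := F.cover c.toLinearMap
  have h3 := h1 (F.X S h) (subset_convexHull ℝ _ ⟨S, hS, rfl⟩)
  have h4 : ∑ i ∈ S, l i * F.u i x ≤ ∑ i ∈ S, l i * h i :=
    sum_le_sum fun i _ => mul_le_mul_of_nonneg_left (hx i) (hl i)
  have h5 := hc x
  have h6 := hc (F.X S h)
  have h7 : ∑ i ∈ S, l i * F.u i (F.X S h) = ∑ i ∈ S, l i * h i :=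
    sum_congr rfl fun i hi => by rw [F.tight S hS h i hi]
  simp only [ContinuousLinearMap.coe_coe] at h5 h6
  linarith

lemma P_add {a b} (ha : a ∈ F.C) (hb : b ∈ F.C) : F.P (a + b) = F.P a + F.P b := by
  apply subset_antisymm
  · refine F.P_hull.trans (convexHull_min ?_ ((F.convex_P a).add (F.convex_P b)))
    rintro _ ⟨S, hS, rfl⟩
    simp only [map_add]
    exact Set.add_mem_add (F.X_mem ha hS) (F.X_mem hb hS)
  · rintro _ ⟨x, hx, y, hy, rfl⟩ j
    simp only [map_add]
    exact add_le_add (hx j) (hy j)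

lemma P_smul {t : ℝ} (ht : 0 < t) (h) : F.P (t • h) = t • F.P h := by
  ext x
  rw [Set.mem_smul_set_iff_inv_smul_mem₀ ht.ne']
  refine forall_congr' fun j => ?_
  simp only [map_smul, smul_eq_mul, Pi.smul_apply]
  rw [inv_mul_le_iff₀ ht]

lemma norm {h} (hh : h ∈ F.C) {S} (hS : F.D S) :
    ∃ a, (∀ j ∈ S, (h - F.U a) j = 0) ∧ ∀ j ∉ S, 0 < (h - F.U a) j := by
  obtain ⟨T, hT, hST⟩ := hS
  set y : J → ℝ := fun j => if j ∈ S then 0 else -1 with hy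
  have hd1 : ∀ j ∈ T, F.u j (F.X T y) = y j := fun j hj => F.tight T hT _ j hj
  obtain ⟨N, hN⟩ := F.C_big hh y
  have h1 := hN (N + 1) (by linarith)
  have hpos : (0 : ℝ) < N + 1 := by positivity
  have ev : ∀ j, (h - F.U (F.X T h + (N + 1 : ℝ)⁻¹ • F.X T y)) j =
      h j - (F.u j (F.X T h) + (N + 1 : ℝ)⁻¹ * F.u j (F.X T y)) := by
    intro j
    rw [Pi.sub_apply, U_apply, map_add, map_smul, smul_eq_mul]
  refine ⟨F.X T h + (N + 1 : ℝ)⁻¹ • F.X T y, fun j hj => ?_, fun j hj => ?_⟩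
  · rw [ev, F.tight T hT h j (hST hj), hd1 j (hST hj)]
    simp [hy, hj]
  · have hyj : y j = -1 := by simp [hy, hj]
    rw [ev]
    by_cases hjT : j ∈ T
    · rw [F.tight T hT h j hjT, hd1 j hjT, hyj]
      have := inv_pos.2 hpos
      linarith
    · have h3 := h1 T hT j hjT
      simp only [map_add, map_smul, smul_eq_mul, Pi.add_apply, Pi.smul_apply] at h3
      have h4 : (N + 1 : ℝ) * (h j - (F.u j (F.X T h) + (N + 1 : ℝ)⁻¹ * F.u j (F.X T y))) =
        (N + 1) * h j - ((N + 1) * F.u j (F.X T h) + F.u j (F.X T y)) := by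
        field_simp
      have h5 : 0 < (N + 1 : ℝ) * (h j - (F.u j (F.X T h) + (N + 1 : ℝ)⁻¹ * F.u j (F.X T y))) := by
        rw [h4]; linarith
      exact pos_of_mul_pos_right h5 hpos.le

lemma intp (x) {S} (hS : F.D S) : ∃ a, ∀ j ∈ S, (x - F.U a) j = 0 := by
  obtain ⟨T, hT, hST⟩ := hS
  exact ⟨F.X T x, fun j hj => by simp [F.tight T hT x j (hST hj)]⟩

lemma ext {S} (hS : F.D S) (hc : S.card < n) : ∃ j ∉ S, F.D (insert j S) := by
  obtain ⟨T, hT, hST⟩ := hS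
  rw [← F.card T hT] at hc
  obtain ⟨j, hj, hjS⟩ := exists_mem_notMem_of_card_lt_card hc
  exact ⟨j, hjS, T, hT, insert_subset hj hST⟩

lemma down {S T} (hS : F.D S) (h : T ⊆ S) : F.D T := by
  obtain ⟨R, hR, hSR⟩ := hS
  exact ⟨R, hR, h.trans hSR⟩

lemma rec0 {x} (hx : ∀ j, F.u j x ≤ 0) : x = 0 := by
  ext i
  have : ∀ c : (Fin n → ℝ) →ₗ[ℝ] ℝ, c x ≤ 0 := by
    intro c
    obtain ⟨S, hS, l, hl, hc⟩ := F.cover c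
    rw [hc]
    exact sum_nonpos fun i _ => mul_nonpos_of_nonneg_of_nonpos (hl i) (hx i)
  have h1 := this (LinearMap.proj i)
  have h2 := this (-LinearMap.proj i)
  simp at h1 h2
  exact le_antisymm h1 h2

lemma conn {S} (hS : F.D S) (hc : S.card + 2 ≤ n) (T : Set J) {j k : J} (hj : j ∈ T) (hk : k ∉ T)
    (hjS : j ∉ S) (hkS : k ∉ S) (hjD : F.D (insert j S)) (hkD : F.D (insert k S)) :
    ∃ j ∈ T, ∃ k ∉ T, j ∉ S ∧ k ∉ S ∧ F.D (insert j (insert k S)) := by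
  obtain ⟨h, hh⟩ := F.Cne
  obtain ⟨a, g0, g1⟩ := F.norm hh hS
  set g := h - F.U a with hg
  have hgC : g ∈ F.C := by
    have := F.C_U (h := h) hh (-a)
    rwa [map_neg, ← sub_eq_add_neg] at this
  let L : (Fin n → ℝ) →ₗ[ℝ] (S → ℝ) := LinearMap.pi fun i => F.u i.1
  let W := LinearMap.ker L
  have hW : ∀ x, x ∈ W ↔ ∀ i ∈ S, F.u i x = 0 := by
    intro x
    simp only [W, L, LinearMap.mem_ker, funext_iff, LinearMap.pi_apply]
    simp
  have hrank : 1 < Module.rank ℝ W := by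
    have h1 := L.finrank_range_add_finrank_ker
    have h2 := (LinearMap.range L).finrank_le
    simp at h1 h2
    apply Module.lt_rank_of_lt_finrank
    show 1 < Module.finrank ℝ (LinearMap.ker L)
    omega
  have hconn := (isConnected_compl_singleton_of_one_lt_rank hrank (0 : W)).isPreconnected
  rw [isPreconnected_closed_iff] at hconn
  let cl : Set J → Set W := fun R => ⋃ j ∈ {j | j ∈ R ∧ j ∉ S}, ⋂ k ∈ {k | k ∉ S},
    {x : W | F.u k x.1 / g k ≤ F.u j x.1 / g j}
  have hcl : ∀ R, IsClosed (cl R) := by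
    intro R
    refine Set.Finite.isClosed_biUnion (Set.toFinite _) fun j _ => ?_
    refine isClosed_biInter fun k _ => ?_
    have hkc : ∀ k, Continuous fun x : W => F.u k x.1 := fun k =>
      (F.cont k).comp continuous_subtype_val
    exact isClosed_le ((hkc k).div_const _) ((hkc j).div_const _)
  have hmem : ∀ R (x : W), x ∈ cl R ↔ ∃ j, (j ∈ R ∧ j ∉ S) ∧ ∀ k ∉ S,
      F.u k x.1 / g k ≤ F.u j x.1 / g j := by
    intro R x; simp [cl]
  have hne : ∀ R : Set J, ∀ j ∈ R, j ∉ S → F.D (insert j S) → (({0}ᶜ : Set W) ∩ cl R).Nonempty := by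
    rintro R j hjR hjS ⟨T', hT', hjT'⟩
    have ht := F.tight T' hT' g
    have hjg : F.u j (F.X T' g) = g j := ht j (hjT' (mem_insert_self _ _))
    have hgj := g1 j hjS
    refine ⟨⟨F.X T' g, (hW _).2 fun i hi => ?_⟩, ?_, ?_⟩
    · rw [ht i (hjT' (mem_insert_of_mem hi)), g0 i hi]
    · intro h0
      simp only [Set.mem_singleton_iff, Subtype.ext_iff] at h0
      have h0' : F.X T' g = 0 := h0
      rw [h0', map_zero] at hjg
      linarith
    · rw [hmem]
      refine ⟨j, ⟨hjR, hjS⟩, fun k hk => ?_⟩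
      simp only [hjg]
      rw [div_self hgj.ne', div_le_one (g1 k hk)]
      exact F.X_mem hgC hT' k
  have hcov : ({0}ᶜ : Set W) ⊆ cl T ∪ cl Tᶜ := by
    intro x _
    obtain ⟨j', hj', hmax⟩ := exists_max_image (univ.filter fun j => j ∉ S)
      (fun j => F.u j x.1 / g j) ⟨j, by simp [hjS]⟩
    simp only [mem_filter, mem_univ, true_and] at hj' hmax
    by_cases hT : j' ∈ T
    · exact Or.inl ((hmem _ _).2 ⟨j', ⟨hT, hj'⟩, hmax⟩)
    · exact Or.inr ((hmem _ _).2 ⟨j', ⟨hT, hj'⟩, hmax⟩)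
  obtain ⟨x, hx0, hx1, hx2⟩ := hconn (cl T) (cl Tᶜ) (hcl _) (hcl _) hcov (hne T j hj hjS hjD)
    (hne Tᶜ k hk hkS hkD)
  obtain ⟨j', ⟨hj'T, hj'S⟩, hj'⟩ := (hmem _ _).1 hx1
  obtain ⟨k', ⟨hk'T, hk'S⟩, hk'⟩ := (hmem _ _).1 hx2
  refine ⟨j', hj'T, k', hk'T, hj'S, hk'S, ?_⟩
  have heq : F.u k' x.1 / g k' = F.u j' x.1 / g j' := le_antisymm (hj' k' hk'S) (hk' j' hj'S)
  set m := F.u j' x.1 / g j' with hm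
  have hxS := (hW _).1 x.2
  have hmpos : 0 < m := by
    by_contra hneg
    push Not at hneg
    apply hx0
    simp only [Set.mem_singleton_iff, Subtype.ext_iff]
    refine F.rec0 fun i => ?_
    by_cases hi : i ∈ S
    · exact (hxS i hi).le
    · have := (hj' i hi).trans hneg
      rw [div_le_iff₀ (g1 i hi)] at this
      simpa using this
  apply F.tightD hgC (x := m⁻¹ • x.1)
  · intro i
    rw [map_smul, smul_eq_mul, inv_mul_le_iff₀ hmpos]
    by_cases hi : i ∈ S
    · rw [hxS i hi, g0 i hi, mul_zero]
    · exact (div_le_iff₀ (g1 i hi)).1 (hj' i hi)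
  · intro i hi
    rw [map_smul, smul_eq_mul, inv_mul_eq_iff_eq_mul₀ hmpos.ne']
    simp only [mem_insert] at hi
    rcases hi with rfl | rfl | hi
    · exact (div_eq_iff (g1 _ hj'S).ne').1 hm.symm
    · exact (div_eq_iff (g1 _ hk'S).ne').1 heq
    · rw [hxS i hi, g0 i hi, mul_zero]

end Fan

end AFx


namespace AFx

section dl
variable {V : Type*} [AddCommGroup V]

/-- forward difference -/
def fd (y : V) (F : V → ℝ) : V → ℝ := fun h => F (h + y) - F h

instance : LeftCommutative (fd : V → (V → ℝ) → V → ℝ) := ⟨fun a b F => by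
  funext h
  simp only [fd]
  rw [add_right_comm]; ring⟩

/-- iterated forward difference -/
def dl (s : Multiset V) (F : V → ℝ) : V → ℝ := s.foldr fd F

@[simp] lemma dl_zero (F : V → ℝ) : dl 0 F = F := rfl
lemma dl_cons (a : V) (s) (F : V → ℝ) : dl (a ::ₘ s) F = fd a (dl s F) := Multiset.foldr_cons ..
lemma dl_add (s t) (F : V → ℝ) : dl (s + t) F = dl s (dl t F) := by
  simp [dl, Multiset.foldr_add]
lemma dl_fd (a : V) (s) (F : V → ℝ) : dl s (fd a F) = fd a (dl s F) := by
  rw [← dl_cons, ← Multiset.singleton_add, add_comm, dl_add]; rfl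
lemma dl_cons' (a : V) (s) (F : V → ℝ) : dl (a ::ₘ s) F = dl s (fd a F) := by
  rw [dl_fd, dl_cons]

lemma dl_shift (s : Multiset V) (F : V → ℝ) (y : V) :
    dl s (fun h => F (h + y)) = fun h => dl s F (h + y) := by
  induction s using Multiset.induction_on with
  | empty => rfl
  | cons a s ih =>
    rw [dl_cons, ih, dl_cons]
    funext h
    simp only [fd]
    rw [add_right_comm]

lemma dl_sum2 (s : Multiset V) (F G : V → ℝ) :
    dl s (fun h => F h + G h) = fun h => dl s F h + dl s G h := by
  induction s using Multiset.induction_on with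
  | empty => rfl
  | cons a s ih =>
    rw [dl_cons, ih, dl_cons, dl_cons]
    funext h
    simp only [fd]
    ring

lemma dl_neg (s : Multiset V) (F : V → ℝ) :
    dl s (fun h => - F h) = fun h => - dl s F h := by
  induction s using Multiset.induction_on with
  | empty => rfl
  | cons a s ih =>
    rw [dl_cons, ih, dl_cons]
    funext h
    simp only [fd]
    ring

lemma dl_zero_fun (s : Multiset V) : dl s (fun _ => (0 : ℝ)) = fun _ => 0 := by
  induction s using Multiset.induction_on with
  | empty => rfl
  | cons a s ih =>
    rw [dl_cons, ih]
    funext h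
    simp [fd]

lemma fd_add (x y : V) (F : V → ℝ) : fd (x + y) F = fun h => fd x F (h + y) + fd y F h := by
  funext h
  simp only [fd]
  rw [add_assoc, add_comm y x]; ring

lemma fd_neg (x : V) (F : V → ℝ) : fd (-x) F = fun h => - fd x F (h + -x) := by
  funext h
  simp [fd]

lemma dl_fd_add (w) (x y : V) (F : V → ℝ) (h) :
    dl w (fd (x + y) F) h = dl w (fd x F) (h + y) + dl w (fd y F) h := by
  rw [fd_add, dl_sum2 w (fun h => fd x F (h + y)), dl_shift]

lemma dl_fd_neg (w) (x : V) (F : V → ℝ) (h) :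
    dl w (fd (-x) F) h = - dl w (fd x F) (h + -x) := by
  rw [fd_neg, dl_neg w (fun h => fd x F (h + -x)), dl_shift]

lemma fd_zero (F : V → ℝ) : fd 0 F = fun _ => 0 := by
  funext h
  simp [fd]

end dl

namespace Fan

variable {n : ℕ} {J : Type*} [Fintype J] [DecidableEq J] (F : Fan n J)

/-- slab -/
def slab (S : Finset J) (s h : J → ℝ) : Set (Fin n → ℝ) :=
  {x | ∀ j, F.u j x ≤ h j + (if j ∈ S then s j else 0) ∧ (j ∈ S → h j < F.u j x)}

noncomputable def G (S : Finset J) (s h : J → ℝ) : ℝ := volume.real (F.slab S s h)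
noncomputable def f (h : J → ℝ) : ℝ := volume.real (F.P h)

lemma slab_meas (S s h) : MeasurableSet (F.slab S s h) := by
  have : F.slab S s h = ⋂ j, ({x | F.u j x ≤ h j + (if j ∈ S then s j else 0)} ∩
      {x | j ∈ S → h j < F.u j x}) := by ext; simp [slab, forall_and]
  rw [this]
  refine MeasurableSet.iInter fun j => ?_
  refine (measurableSet_le (F.cont j).measurable measurable_const).inter ?_
  by_cases hj : j ∈ S
  · simp only [hj, true_imp_iff]
    exact measurableSet_lt measurable_const (F.cont j).measurable
  · simp [hj]

lemma slab_fin (S s h) : volume (F.slab S s h) ≠ ⊤ := by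
  have : F.slab S s h ⊆ F.P (fun j => h j + (if j ∈ S then s j else 0)) := fun x hx j => (hx j).1
  exact ((F.bdd _).subset this).measure_lt_top.ne

lemma G_nonneg (S s h) : 0 ≤ F.G S s h := measureReal_nonneg

lemma G_empty (s h) : F.G ∅ s h = F.f h := by
  simp [G, f, slab, P]

lemma G_trans (S s h a) : F.G S s (h + F.U a) = F.G S s h := by
  have : F.slab S s h = (fun x => x + a) ⁻¹' (F.slab S s (h + F.U a)) := by
    ext x
    refine forall_congr' fun j => ?_
    simp only [map_add, Pi.add_apply, U_apply]
    rw [add_right_comm, add_le_add_iff_right, add_lt_add_iff_right]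
  unfold G
  rw [this, measureReal_def, measureReal_def, measure_preimage_add_right]

lemma G_insert {S : Finset J} {j : J} (hj : j ∉ S) (s : J → ℝ) {t : ℝ} (ht : 0 < t) :
    F.G (insert j S) (Function.update s j t) = fd (Pi.single j t) (F.G S s) := by
  funext h
  have hne : ∀ i ∈ S, i ≠ j := fun i hi e => hj (e ▸ hi)
  have h1 : F.slab S s h ⊆ F.slab S s (h + Pi.single j t) := by
    intro x hx i
    have := hx i
    by_cases hi : i = j
    · subst hi
      simp only [hj, if_false, add_zero] at this
      simp [hj]; linarith [this.1]
    · simpa [hi] using this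
  have h2 : F.slab (insert j S) (Function.update s j t) h =
      F.slab S s (h + Pi.single j t) \ F.slab S s h := by
    ext x
    constructor
    · intro hx
      refine ⟨fun i => ?_, fun hx' => ?_⟩
      · have := hx i
        by_cases hi : i = j
        · subst hi
          simp only [mem_insert, true_or, if_true, Function.update_self, true_imp_iff] at this
          simpa [hj] using this.1
        · simpa [hi] using this
      · have h3 := (hx j).2 (by simp)
        have h4 := (hx' j).1
        simp [hj] at h4
        linarith
    · rintro ⟨hx, hx'⟩ i
      have hxj := (hx j).1
      simp only [Pi.add_apply, Pi.single_eq_same, hj, if_false, add_zero] at hxj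
      by_cases hi : i = j
      · subst hi
        simp only [mem_insert, true_or, if_true, Function.update_self, true_imp_iff]
        refine ⟨hxj, ?_⟩
        by_contra hcon
        push Not at hcon
        apply hx'
        intro k
        have := hx k
        by_cases hk : k = i
        · subst hk
          simpa [hj] using hcon
        · simpa [hk] using this
      · have := hx i
        simpa [hi] using this
  unfold G fd
  rw [h2, measureReal_sdiff h1 (F.slab_meas _ _ _) (F.slab_fin _ _ _)]

/-- eventually in the cone -/
def Ev (p : (J → ℝ) → Prop) : Prop := ∃ c, ∀ h, h - c ∈ F.C → p h

variable {F}

lemma Ev.mono {p q : (J → ℝ) → Prop} (hp : F.Ev p) (h : ∀ x, p x → q x) : F.Ev q := by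
  obtain ⟨c, hc⟩ := hp
  exact ⟨c, fun x hx => h x (hc x hx)⟩

lemma Ev.shift {p : (J → ℝ) → Prop} (hp : F.Ev p) (y) : F.Ev fun h => p (h + y) := by
  obtain ⟨c, hc⟩ := hp
  exact ⟨c - y, fun x hx => hc _ (by convert hx using 1; abel)⟩

lemma Ev.and {p q : (J → ℝ) → Prop} (hp : F.Ev p) (hq : F.Ev q) : F.Ev fun h => p h ∧ q h := by
  obtain ⟨c, hc⟩ := hp
  obtain ⟨d, hd⟩ := hq
  obtain ⟨h0, hh0⟩ := F.Cne
  obtain ⟨N, hN⟩ := F.C_big hh0 (-c)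
  obtain ⟨M, hM⟩ := F.C_big hh0 (-d)
  refine ⟨((N + M : ℕ) : ℝ) • h0, fun h hh => ⟨hc _ ?_, hd _ ?_⟩⟩
  · have := F.C_add hh (hN (N + M : ℕ) (by push_cast; linarith [Nat.cast_nonneg (α := ℝ) M]))
    convert this using 1; abel
  · have := F.C_add hh (hM (N + M : ℕ) (by push_cast; linarith [Nat.cast_nonneg (α := ℝ) N]))
    convert this using 1; abel

lemma Ev.along {p : (J → ℝ) → Prop} (hp : F.Ev p) {h} (hh : h ∈ F.C) (y) :
    ∀ᶠ m : ℕ in Filter.atTop, p ((m : ℝ) • h + y) := by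
  obtain ⟨c, hc⟩ := hp
  obtain ⟨N, hN⟩ := F.C_big hh (y - c)
  filter_upwards [Filter.eventually_ge_atTop N] with m hm
  refine hc _ ?_
  have := hN m (by exact_mod_cast hm)
  convert this using 1; abel

lemma Ev.of {p : (J → ℝ) → Prop} (hp : ∀ h, p h) : F.Ev p := ⟨0, fun h _ => hp h⟩

lemma Ev.dl0 {g : (J → ℝ) → ℝ} (hg : F.Ev fun h => g h = 0) (w) : F.Ev fun h => dl w g h = 0 := by
  induction w using Multiset.induction_on with
  | empty => exact hg
  | cons a w ih =>
    rw [dl_cons]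
    exact (ih.and (ih.shift a)).mono fun h hh => by simp [fd, hh.1, hh.2]

variable (F)

lemma isOpen_C : IsOpen F.C := by
  have : F.C = ⋂ S ∈ F.B, ⋂ j ∈ Sᶜ, {h | F.u j (F.X S h) < h j} := by
    ext h; simp [C]
  rw [this]
  refine isOpen_biInter_finset fun S _ => isOpen_biInter_finset fun j _ => ?_
  refine isOpen_lt ((F.cont j).comp ?_) (continuous_apply j)
  exact LinearMap.continuous_of_finiteDimensional _

lemma C_unif (M : ℝ) : ∃ c, ∀ z : J → ℝ, ‖z‖ ≤ M → c + z ∈ F.C := by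
  obtain ⟨h0, hh0⟩ := F.Cne
  obtain ⟨r, hr, hb⟩ := Metric.isOpen_iff.1 F.isOpen_C h0 hh0
  have ht : 0 < (|M| + 1) / r := by positivity
  refine ⟨((|M| + 1) / r) • h0, fun z hz => ?_⟩
  have : h0 + ((|M| + 1) / r)⁻¹ • z ∈ F.C := by
    apply hb
    rw [Metric.mem_ball, dist_eq_norm, add_sub_cancel_left, norm_smul, norm_inv,
      Real.norm_of_nonneg ht.le, inv_mul_lt_iff₀ ht, div_mul_cancel₀ _ hr.ne']
    have := le_abs_self M
    linarith
  have := F.C_smul this ht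
  rwa [smul_add, smul_inv_smul₀ ht.ne'] at this

lemma vanish {S : Finset J} (hS : ¬ F.D S) (s : J → ℝ) : F.Ev fun h => F.G S s h = 0 := by
  obtain ⟨c, hc⟩ := F.C_unif ‖s‖
  refine ⟨c, fun h hh => ?_⟩
  have : F.slab S s h = ∅ := by
    rw [Set.eq_empty_iff_forall_notMem]
    intro x hx
    apply hS
    set z : J → ℝ := fun j => if j ∈ S then F.u j x - h j else 0 with hz
    have hzn : ‖z‖ ≤ ‖s‖ := by
      rw [pi_norm_le_iff_of_nonneg (norm_nonneg _)]
      intro j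
      by_cases hj : j ∈ S
      · have h1 := (hx j).1
        have h2 := (hx j).2 hj
        simp only [hj, if_true] at h1
        have h3 := norm_le_pi_norm s j
        rw [Real.norm_eq_abs] at h3
        simp only [hz, hj, if_true]
        rw [Real.norm_of_nonneg (by linarith)]
        linarith [le_abs_self (s j)]
      · simp [hz, hj]
    have h1 : h + z ∈ F.C := by
      have := F.C_add hh (hc z hzn)
      convert this using 1; abel
    refine F.tightD h1 (x := x) (fun j => ?_) (fun j hj => ?_)
    · by_cases hj : j ∈ S
      · simp [hz, hj]
      · have := (hx j).1
        simpa [hz, hj] using this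
    · simp [hz, hj]
  simp [G, this]

lemma fd_trans (S s) (a : J → ℝ) (b) : fd a (F.G S s) = fd (a - F.U b) (F.G S s) := by
  funext h
  simp only [fd]
  rw [← F.G_trans S s (h + (a - F.U b)) b]
  congr 2
  abel

/-- expansion principle -/
lemma expandEv (S : Finset J) (s : J → ℝ) (w : Multiset (J → ℝ)) (R : Set ℝ) (hR0 : 0 ∈ R)
    (hRadd : ∀ a ∈ R, ∀ b ∈ R, a + b ∈ R) (x : J → ℝ) (hx : ∀ j ∈ S, x j = 0)
    (h : ∀ j ∉ S, F.Ev fun h => dl w (fd (Pi.single j (x j)) (F.G S s)) h ∈ R) :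
    F.Ev fun h => dl w (fd x (F.G S s)) h ∈ R := by
  have key : ∀ T : Finset J, F.Ev fun h => dl w (fd (∑ j ∈ T, Pi.single j (x j)) (F.G S s)) h ∈ R := by
    intro T
    induction T using Finset.induction_on with
    | empty =>
      apply Ev.of
      intro h
      rw [sum_empty, fd_zero, dl_zero_fun]; exact hR0
    | insert j T hj ih =>
      rw [sum_insert hj]
      have h1 : F.Ev fun h => dl w (fd (Pi.single j (x j)) (F.G S s)) h ∈ R := by
        by_cases hjS : j ∈ S
        · apply Ev.of
          intro h
          rw [hx j hjS, Pi.single_zero, fd_zero, dl_zero_fun]; exact hR0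
        · exact h j hjS
      refine ((h1.shift (∑ j ∈ T, Pi.single j (x j))).and ih).mono fun h hh => ?_
      rw [dl_fd_add]
      exact hRadd _ hh.1 _ hh.2
  have := key univ
  rwa [Finset.univ_sum_single] at this

lemma key : ∀ (w : Multiset (J → ℝ)) (S : Finset J) (s : J → ℝ), (∀ j, 0 < s j) →
    n + 1 ≤ S.card + Multiset.card w → F.Ev fun h => dl w (F.G S s) h = 0 := by
  intro w
  induction w using Multiset.induction_on with
  | empty =>
    intro S s _ hc
    refine F.vanish ?_ s
    rintro ⟨T, hT, hST⟩
    have := card_le_card hST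
    rw [F.card T hT] at this
    simp at hc; omega
  | cons a w ih =>
    intro S s hs hc
    rw [Multiset.card_cons] at hc
    by_cases hS : F.D S
    swap
    · exact (F.vanish hS s).dl0 _
    obtain ⟨b, hb⟩ := F.intp a hS
    rw [dl_cons', F.fd_trans S s a b]
    have pos : ∀ j ∉ S, ∀ t : ℝ, 0 < t →
        F.Ev fun h => dl w (fd (Pi.single j t) (F.G S s)) h = 0 := by
      intro j hj t ht
      rw [← F.G_insert hj s ht]
      refine ih _ _ (fun i => ?_) (by rw [card_insert_of_notMem hj]; omega)
      by_cases hi : i = j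
      · subst hi; simpa using ht
      · simpa [hi] using hs i
    refine F.expandEv S s w {0} rfl (by simp) _ hb fun j hj => ?_
    simp only [Set.mem_singleton_iff]
    generalize (a - F.U b) j = t
    rcases lt_trichotomy t 0 with ht | rfl | ht
    · have h1 := pos j hj (-t) (by linarith)
      have h2 : (Pi.single j t : J → ℝ) = -(Pi.single j (-t)) := by
        rw [← Pi.single_neg, neg_neg]
      rw [h2]
      exact (h1.shift (-Pi.single j (-t))).mono fun h hh => by rw [dl_fd_neg, hh, neg_zero]
    · apply Ev.of
      intro h
      rw [Pi.single_zero, fd_zero, dl_zero_fun]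
    · exact pos j hj t ht

lemma nonneg : ∀ (w : Multiset (J → ℝ)), (∀ v ∈ w, v ∈ F.C) → ∀ (S : Finset J) (s : J → ℝ),
    (∀ j, 0 < s j) → F.Ev fun h => 0 ≤ dl w (F.G S s) h := by
  intro w
  induction w using Multiset.induction_on with
  | empty => intro _ S s _; exact Ev.of fun h => F.G_nonneg S s h
  | cons a w ih =>
    intro hw S s hs
    by_cases hS : F.D S
    swap
    · exact ((F.vanish hS s).dl0 _).mono fun h hh => hh.ge
    obtain ⟨b, hb0, hb1⟩ := F.norm (hw a (by simp)) hS
    rw [dl_cons', F.fd_trans S s a b]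
    refine F.expandEv S s w (Set.Ici 0) (by simp) 
      (fun a ha b hb => add_nonneg (Set.mem_Ici.1 ha) (Set.mem_Ici.1 hb)) _ hb0
      fun j hj => ?_
    rw [← F.G_insert hj s (hb1 j hj)]
    refine ih (fun v hv => hw v (by simp [hv])) _ _ (fun i => ?_)
    by_cases hi : i = j
    · subst hi; simpa using hb1 i hj
    · simpa [hi] using hs i

lemma dl_eM (S : Finset J) : dl (eM S) F.f = F.G S 1 := by
  induction S using Finset.induction_on with
  | empty => funext h; simp [eM, F.G_empty]
  | insert j S hj ih =>
    rw [eM_insert hj, dl_cons, ih, ← F.G_insert hj 1 one_pos]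
    congr 1
    ext i
    by_cases hi : i = j
    · subst hi; simp
    · simp [hi]

end Fan

end AFx


namespace AFx

lemma add_nonneg_linear (φ : ℝ → ℝ) (hadd : ∀ a b, φ (a + b) = φ a + φ b)
    (hnn : ∀ t, 0 < t → 0 ≤ φ t) (t : ℝ) : φ t = t * φ 1 := by
  have h0 : φ 0 = 0 := by have := hadd 0 0; simp at this; exact this
  have hmono : ∀ a b, a ≤ b → φ a ≤ φ b := by
    intro a b hab
    rcases hab.eq_or_lt with rfl | hab
    · exact le_rfl
    · have := hadd a (b - a)
      rw [add_sub_cancel] at this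
      linarith [hnn (b - a) (by linarith)]
  have hneg : ∀ a, φ (-a) = - φ a := by
    intro a; have := hadd a (-a); rw [add_neg_cancel, h0] at this; linarith
  have hnat : ∀ (m : ℕ) a, φ (m * a) = m * φ a := by
    intro m a
    induction m with
    | zero => simp [h0]
    | succ m ih => push_cast; rw [add_mul, hadd, ih, one_mul, add_mul, one_mul]
  have hint : ∀ (m : ℤ), φ m = m * φ 1 := by
    intro m
    obtain ⟨k, rfl | rfl⟩ := m.eq_nat_or_neg
    · have := hnat k 1; simpa using this
    · push_cast; rw [hneg]; have := hnat k 1; simp at this; rw [this]; ring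
  have hb : ∀ m : ℕ, |m * (φ t - t * φ 1)| ≤ φ 1 := by
    intro m
    have h1 := hmono _ _ (Int.floor_le ((m : ℝ) * t))
    have h2 := hmono _ _ (Int.lt_floor_add_one ((m : ℝ) * t)).le
    rw [hadd] at h2
    rw [hint, hnat] at h1
    rw [hint, hnat] at h2
    have h3 := Int.floor_le ((m : ℝ) * t)
    have h4 := Int.lt_floor_add_one ((m : ℝ) * t)
    have h5 := hnn 1 one_pos
    rw [abs_le]
    constructor <;> nlinarith
  by_contra hne
  have hd : 0 < |φ t - t * φ 1| := abs_pos.2 (sub_ne_zero.2 hne)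
  obtain ⟨m, hm⟩ := exists_nat_gt (φ 1 / |φ t - t * φ 1|)
  rw [div_lt_iff₀ hd] at hm
  have := hb m
  rw [abs_mul, Nat.abs_cast] at this
  linarith

/-- quadratic growth -/
lemma quad_lim (a : ℕ → ℝ) (q : ℝ) (h : ∀ᶠ m in Filter.atTop, a (m + 2) - 2 * a (m + 1) + a m = q) :
    Filter.Tendsto (fun m : ℕ => a m / (m : ℝ) ^ 2) Filter.atTop (nhds (q / 2)) := by
  obtain ⟨M, hM⟩ := Filter.eventually_atTop.1 h
  have h1 : ∀ k : ℕ, a (M + k) = a M + k * (a (M + 1) - a M) + k * (k - 1) / 2 * q ∧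
      a (M + k + 1) = a M + (k + 1) * (a (M + 1) - a M) + (k + 1) * k / 2 * q := by
    intro k
    induction k with
    | zero => simp
    | succ k ih =>
      refine ⟨?_, ?_⟩
      · rw [← add_assoc, ih.2]; push_cast; ring
      · have := hM (M + k) (by omega)
        have e : a (M + (k + 1) + 1) = a (M + k + 2) := by congr 1
        rw [e]
        push_cast
        have h2 := ih.1
        have h3 := ih.2
        rw [h2, h3] at this
        linarith
  set d := a (M + 1) - a M
  have h2 : ∀ m : ℕ, M ≤ m → a m = (a M - M * d + (M : ℝ) * (M + 1) / 2 * q) +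
      m * (d - M * q - q / 2) + m ^ 2 * (q / 2) := by
    intro m hm
    obtain ⟨k, rfl⟩ := Nat.exists_eq_add_of_le hm
    rw [(h1 k).1]; push_cast; ring
  set A := (a M - M * d + (M : ℝ) * (M + 1) / 2 * q)
  set B := (d - M * q - q / 2)
  have hinv : Filter.Tendsto (fun m : ℕ => ((m : ℝ))⁻¹) Filter.atTop (nhds 0) :=
    tendsto_inv_atTop_nhds_zero_nat
  have h3 : Filter.Tendsto (fun m : ℕ => A * ((m : ℝ)⁻¹ * (m : ℝ)⁻¹) + (m : ℝ)⁻¹ * B + q / 2)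
      Filter.atTop (nhds (A * (0 * 0) + 0 * B + q / 2)) :=
    (((hinv.mul hinv).const_mul A).add (hinv.mul_const B)).add_const _
  simp only [mul_zero, zero_mul, zero_add] at h3
  refine h3.congr' ?_
  filter_upwards [Filter.eventually_ge_atTop M, Filter.eventually_gt_atTop 0] with m hm hm0
  rw [h2 m hm]
  have : (m : ℝ) ≠ 0 := by positivity
  field_simp

namespace Fan

variable {n : ℕ} {J : Type*} [Fintype J] [DecidableEq J] (F : Fan n J)

/-- eventual value -/
def Lim (g : (J → ℝ) → ℝ) (q : ℝ) : Prop :=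
  ∀ h ∈ F.C, ∀ y, ∀ᶠ m : ℕ in Filter.atTop, g ((m : ℝ) • h + y) = q

variable {F}

lemma Lim.unique {g : (J → ℝ) → ℝ} {q q' : ℝ} (h1 : F.Lim g q) (h2 : F.Lim g q') : q = q' := by
  obtain ⟨h, hh⟩ := F.Cne
  obtain ⟨m, hm, hm'⟩ := ((h1 h hh 0).and (h2 h hh 0)).exists
  exact hm.symm.trans hm'

lemma Lim.of_ev {g : (J → ℝ) → ℝ} (hg : ∀ y, F.Ev fun h => g (h + y) = g h) : ∃ q, F.Lim g q := by
  obtain ⟨h0, hh0⟩ := F.Cne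
  have key : ∀ y, ∃ c, ∀ h, h - c ∈ F.C → ∀ y' ∈ F.C, y' = y → ∀ k : ℕ, g (h + (k : ℝ) • y) = g h := by
    intro y
    obtain ⟨c, hc⟩ := hg y
    refine ⟨c, fun h hh y' hy' e k => ?_⟩
    subst e
    induction k with
    | zero => simp
    | succ k ih =>
      have : h + ((k + 1 : ℕ) : ℝ) • y' = (h + (k : ℝ) • y') + y' := by
        push_cast; rw [add_smul, one_smul, add_assoc]
      rw [this, hc, ih]
      rcases Nat.eq_zero_or_pos k with rfl | hk
      · simpa using hh
      · have := F.C_add hh (F.C_smul hy' (t := k) (by exact_mod_cast hk))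
        convert this using 1; abel
  -- value for one ray
  have ray : ∀ h ∈ F.C, ∃ q, ∀ᶠ m : ℕ in Filter.atTop, g ((m : ℝ) • h) = q := by
    intro h hh
    obtain ⟨c, hc⟩ := key h
    obtain ⟨N, hN⟩ := F.C_big hh (-c)
    refine ⟨g ((N : ℝ) • h), ?_⟩
    filter_upwards [Filter.eventually_ge_atTop N] with m hm
    obtain ⟨k, rfl⟩ := Nat.exists_eq_add_of_le hm
    have := hc ((N : ℝ) • h) (by rw [sub_eq_add_neg]; exact hN N le_rfl) h hh rfl k
    rw [← this, ← add_smul]; norm_cast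
  obtain ⟨q, hq⟩ := ray h0 hh0
  refine ⟨q, fun h hh y => ?_⟩
  obtain ⟨q', hq'⟩ := ray h hh
  have e : q = q' := by
    obtain ⟨c, hc⟩ := key h
    obtain ⟨c', hc'⟩ := key h0
    obtain ⟨N, hN⟩ := F.C_big hh0 (-c)
    obtain ⟨N', hN'⟩ := F.C_big hh (-c')
    obtain ⟨m, hm1, hm2⟩ := (hq.and (Filter.eventually_ge_atTop N)).exists
    obtain ⟨m', hm'1, hm'2⟩ := (hq'.and (Filter.eventually_ge_atTop N')).exists
    have h1 := hc ((m : ℝ) • h0)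
      (by rw [sub_eq_add_neg]; exact hN m (by exact_mod_cast hm2)) h hh rfl m'
    have h2 := hc' ((m' : ℝ) • h)
      (by rw [sub_eq_add_neg]; exact hN' m' (by exact_mod_cast hm'2)) h0 hh0 rfl m
    rw [← hm1, ← hm'1, ← h1, ← h2, add_comm]
  have h1 := (hg y).along hh 0
  filter_upwards [h1, hq'] with m h2 h3
  rw [add_zero] at h2
  rw [h2, h3, e]

lemma Lim.shift {g : (J → ℝ) → ℝ} {q : ℝ} (h1 : F.Lim g q) (y) : F.Lim (fun h => g (h + y)) q := by
  intro h hh z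
  have := h1 h hh (z + y)
  simpa [add_assoc] using this

lemma Lim.add {g g' : (J → ℝ) → ℝ} {q q' : ℝ} (h1 : F.Lim g q) (h2 : F.Lim g' q') :
    F.Lim (fun h => g h + g' h) (q + q') := by
  intro h hh z
  filter_upwards [h1 h hh z, h2 h hh z] with m e1 e2
  rw [e1, e2]

lemma Lim.ev {g : (J → ℝ) → ℝ} {q : ℝ} (h1 : F.Lim g q) {p : ℝ → Prop} (hp : F.Ev fun h => p (g h)) :
    p q := by
  obtain ⟨h, hh⟩ := F.Cne
  obtain ⟨m, e1, e2⟩ := ((h1 h hh 0).and (hp.along hh 0)).exists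
  rwa [e1] at e2

variable (F)

open Classical in
noncomputable def Q (w : Multiset (J → ℝ)) : ℝ :=
  if h : ∃ q, F.Lim (dl w F.f) q then h.choose else 0

lemma G_e : F.G ∅ 1 = F.f := funext fun h => F.G_empty 1 h

lemma limQ {w : Multiset (J → ℝ)} (hw : Multiset.card w = n) : F.Lim (dl w F.f) (F.Q w) := by
  have : ∃ q, F.Lim (dl w F.f) q := by
    apply Lim.of_ev
    intro y
    have := F.key (y ::ₘ w) ∅ 1 (fun _ => one_pos) (by rw [Multiset.card_cons]; simp; omega)
    rw [F.G_e, dl_cons] at this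
    exact this.mono fun h hh => sub_eq_zero.1 hh
  unfold Q
  rw [dif_pos this]
  exact this.choose_spec

lemma Q_add (s x y) (hs : Multiset.card s + 1 = n) :
    F.Q ((x + y) ::ₘ s) = F.Q (x ::ₘ s) + F.Q (y ::ₘ s) := by
  have h1 := F.limQ (w := (x + y) ::ₘ s) (by rwa [Multiset.card_cons])
  have h2 := F.limQ (w := x ::ₘ s) (by rwa [Multiset.card_cons])
  have h3 := F.limQ (w := y ::ₘ s) (by rwa [Multiset.card_cons])
  refine h1.unique ?_
  have := (h2.shift y).add h3
  convert this using 2 with h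
  simp only [dl_cons']
  rw [dl_fd_add]

lemma Q_nonneg (w) (hw : Multiset.card w = n) (hC : ∀ v ∈ w, v ∈ F.C) : 0 ≤ F.Q w := by
  refine (F.limQ hw).ev (p := fun t => 0 ≤ t) ?_
  have := F.nonneg w hC ∅ 1 (fun _ => one_pos)
  rwa [F.G_e] at this

lemma CsubC (x : J → ℝ) : ∃ a ∈ F.C, ∃ b ∈ F.C, x = a - b := by
  obtain ⟨h, hh⟩ := F.Cne
  obtain ⟨N, hN⟩ := F.C_big hh x
  have hb : ((N : ℝ) + 1) • h ∈ F.C := F.C_smul hh (by positivity)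
  exact ⟨_, hN (N + 1) (by linarith), _, hb, by abel⟩

lemma Q_sub (s x y) (hs : Multiset.card s + 1 = n) :
    F.Q ((x - y) ::ₘ s) = F.Q (x ::ₘ s) - F.Q (y ::ₘ s) := by
  have := F.Q_add s (x - y) y hs
  rw [sub_add_cancel] at this
  linarith

lemma Q_smul (s) (c : ℝ) (x) (hs : Multiset.card s + 1 = n) :
    F.Q ((c • x) ::ₘ s) = c * F.Q (x ::ₘ s) := by
  have main : ∀ (b a : Multiset (J → ℝ)), (∀ v ∈ a, v ∈ F.C) → Multiset.card (a + b) + 1 = n →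
      ∀ x, F.Q ((c • x) ::ₘ (a + b)) = c * F.Q (x ::ₘ (a + b)) := by
    intro b
    induction b using Multiset.induction_on with
    | empty =>
      intro a ha hc x
      rw [add_zero] at hc ⊢
      have hC : ∀ x ∈ F.C, F.Q ((c • x) ::ₘ a) = c * F.Q (x ::ₘ a) := by
        intro x hx
        have := add_nonneg_linear (fun t => F.Q ((t • x) ::ₘ a))
          (fun s t => by simp only [add_smul]; exact F.Q_add _ _ _ hc)
          (fun t ht => F.Q_nonneg _ (by rwa [Multiset.card_cons]) (by
            intro v hv
            rcases Multiset.mem_cons.1 hv with rfl | hv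
            exacts [F.C_smul hx ht, ha _ hv])) c
        simpa using this
      obtain ⟨y, hy, z, hz, rfl⟩ := F.CsubC x
      rw [smul_sub, F.Q_sub _ _ _ hc, F.Q_sub _ _ _ hc, hC y hy, hC z hz]; ring
    | cons d b ih =>
      intro a ha hc x
      obtain ⟨y, hy, z, hz, rfl⟩ := F.CsubC d
      rw [Multiset.add_cons, Multiset.card_cons] at hc
      have hcc : ∀ x : J → ℝ, Multiset.card (x ::ₘ (a + b)) + 1 = n := by
        intro x; rw [Multiset.card_cons]; exact hc
      have hy' := ih (y ::ₘ a) (by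
        intro v hv
        rcases Multiset.mem_cons.1 hv with rfl | hv
        exacts [hy, ha _ hv]) (by rw [Multiset.cons_add]; exact hcc y) x
      have hz' := ih (z ::ₘ a) (by
        intro v hv
        rcases Multiset.mem_cons.1 hv with rfl | hv
        exacts [hz, ha _ hv]) (by rw [Multiset.cons_add]; exact hcc z) x
      rw [Multiset.cons_add] at hy' hz'
      have e1 : ∀ w : J → ℝ, F.Q (w ::ₘ (y - z) ::ₘ (a + b)) =
          F.Q (w ::ₘ y ::ₘ (a + b)) - F.Q (w ::ₘ z ::ₘ (a + b)) := by
        intro w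
        rw [Multiset.cons_swap, F.Q_sub _ _ _ (hcc _), Multiset.cons_swap y, Multiset.cons_swap z]
      rw [Multiset.add_cons, e1, e1, hy', hz']
      ring
  simpa using main s 0 (by simp) (by simpa using hs) x

lemma Q_inv (s) (a) (hs : Multiset.card s + 1 = n) : F.Q (F.U a ::ₘ s) = 0 := by
  refine (F.limQ (by rwa [Multiset.card_cons])).ev (p := fun t => t = 0) (Ev.of fun h => ?_)
  have : fd (F.U a) F.f = fun _ => 0 := by
    funext h
    simp only [fd, ← F.G_e]
    rw [F.G_trans, sub_self]
  rw [dl_cons', this, dl_zero_fun]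

lemma Q_van (S s) (hS : ¬ F.D S) (hs : S.card + Multiset.card s = n) : F.Q (eM S + s) = 0 := by
  refine (F.limQ (by rwa [Multiset.card_add, card_eM])).ev (p := fun t => t = 0) ?_
  rw [add_comm, dl_add, F.dl_eM]
  exact (F.vanish hS 1).dl0 s

lemma Q_pos (S) (hS : F.D S) (hc : S.card = n) : 0 < F.Q (eM S) := by
  refine (F.limQ (by rwa [card_eM])).ev (p := fun t => 0 < t) ?_
  obtain ⟨T, hT, hST⟩ := hS
  have : S = T := eq_of_subset_of_card_le hST (by rw [hc, F.card T hT])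
  subst this
  rw [F.dl_eM]
  set z : J → ℝ := fun j => if j ∈ S then 1/2 else 0 with hz
  refine ⟨-z, fun h hh => ?_⟩
  rw [sub_neg_eq_add] at hh
  unfold G
  rw [measureReal_def]
  refine ENNReal.toReal_pos ?_ (F.slab_fin _ _ _)
  have hO : IsOpen {x | ∀ j, F.u j x < h j + (if j ∈ S then 1 else 0) ∧ (j ∈ S → h j < F.u j x)} := by
    have : {x | ∀ j, F.u j x < h j + (if j ∈ S then 1 else 0) ∧ (j ∈ S → h j < F.u j x)} =
      ⋂ j, ({x | F.u j x < h j + (if j ∈ S then 1 else 0)} ∩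
      {x | j ∈ S → h j < F.u j x}) := by ext; simp [forall_and]
    rw [this]
    refine isOpen_iInter_of_finite fun j => ?_
    refine (isOpen_lt (F.cont j) continuous_const).inter ?_
    by_cases hj : j ∈ S
    · simp only [hj, true_imp_iff]
      exact isOpen_lt continuous_const (F.cont j)
    · simp [hj]
  refine ((hO.measure_pos volume ⟨F.X S (h + z), fun j => ?_⟩).trans_le (measure_mono ?_)).ne'
  · by_cases hj : j ∈ S
    · rw [F.tight S hT _ j hj]
      simp [hz, hj]; norm_num
    · have := hh S hT j hj
      simpa [hj, hz] using this
  · intro x hx j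
    exact ⟨by simpa using (hx j).1.le, (hx j).2⟩

lemma G_bm (S : Finset J) (a b : J → ℝ) :
    F.G S 1 a * F.G S 1 b ≤ F.G S 1 ((1/2 : ℝ) • (a + b)) ^ 2 := by
  have := bm (F.slab_meas S 1 a) (F.slab_meas S 1 b) (F.slab_meas S 1 ((1/2 : ℝ) • (a + b))) (by
    intro x hx y hy j
    have h1 := hx j
    have h2 := hy j
    simp only [map_smul, map_add, smul_eq_mul, Pi.smul_apply, Pi.add_apply, Pi.one_apply] at *
    refine ⟨?_, fun hj => ?_⟩
    · linarith [h1.1, h2.1]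
    · linarith [h1.2 hj, h2.2 hj])
  have h := ENNReal.toReal_mono (ENNReal.pow_ne_top (F.slab_fin _ _ _)) this
  rwa [ENNReal.toReal_mul, ENNReal.toReal_pow] at h

lemma base (S : Finset J) (hc : S.card + 2 = n) (w) (hw : w ∈ F.C) (x : J → ℝ) :
    F.Q (x ::ₘ x ::ₘ eM S) * F.Q (w ::ₘ w ::ₘ eM S) ≤ F.Q (x ::ₘ w ::ₘ eM S) ^ 2 := by
  have cc : ∀ a b : J → ℝ, Multiset.card (a ::ₘ b ::ₘ eM S) = n := by
    intro a b; rw [Multiset.card_cons, Multiset.card_cons, card_eM]; exact hc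
  have cc1 : ∀ b : J → ℝ, Multiset.card (b ::ₘ eM S) + 1 = n := by
    intro b; rw [Multiset.card_cons, card_eM]; exact hc
  have lim : ∀ z ∈ F.C, Filter.Tendsto (fun m : ℕ => F.G S 1 ((m : ℝ) • z) / (m : ℝ) ^ 2)
      Filter.atTop (nhds (F.Q (z ::ₘ z ::ₘ eM S) / 2)) := by
    intro z hz
    refine quad_lim (fun m => F.G S 1 ((m : ℝ) • z)) _ ?_
    filter_upwards [F.limQ (cc z z) z hz 0] with m hm
    rw [← hm, dl_cons, dl_cons, F.dl_eM]
    simp only [fd, add_zero]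
    have e1 : ((m + 2 : ℕ) : ℝ) • z = (m : ℝ) • z + z + z := by
      push_cast; module
    have e2 : ((m + 1 : ℕ) : ℝ) • z = (m : ℝ) • z + z := by
      push_cast; module
    rw [e1, e2]; ring
  have mid : ∀ a ∈ F.C, ∀ b ∈ F.C, F.Q (a ::ₘ a ::ₘ eM S) * F.Q (b ::ₘ b ::ₘ eM S) ≤
      F.Q (((1/2 : ℝ) • (a + b)) ::ₘ ((1/2 : ℝ) • (a + b)) ::ₘ eM S) ^ 2 := by
    intro a ha b hb
    have h1 := (lim a ha).mul (lim b hb)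
    have h2 := (lim _ (F.C_smul (F.C_add ha hb) (by norm_num : (0:ℝ) < 1/2))).pow 2
    have := le_of_tendsto_of_tendsto' h1 h2 (fun m => by
      rw [div_mul_div_comm, div_pow, ← sq ((m : ℝ) ^ 2)]
      apply div_le_div_of_nonneg_right _ (by positivity)
      rw [smul_comm, smul_add]
      exact F.G_bm S _ _)
    nlinarith
  have bil : ∀ (a b : J → ℝ) (s t : ℝ), F.Q ((s • a + t • b) ::ₘ (s • a + t • b) ::ₘ eM S) =
      s ^ 2 * F.Q (a ::ₘ a ::ₘ eM S) + 2 * s * t * F.Q (a ::ₘ b ::ₘ eM S) +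
        t ^ 2 * F.Q (b ::ₘ b ::ₘ eM S) := by
    intro a b s t
    rw [F.Q_add _ _ _ (cc1 _), F.Q_smul _ _ _ (cc1 _), F.Q_smul _ _ _ (cc1 _),
      Multiset.cons_swap a, Multiset.cons_swap b, F.Q_add _ _ _ (cc1 _), F.Q_add _ _ _ (cc1 _),
      F.Q_smul _ _ _ (cc1 _), F.Q_smul _ _ _ (cc1 _), F.Q_smul _ _ _ (cc1 _),
      F.Q_smul _ _ _ (cc1 _), Multiset.cons_swap b a]
    ring
  have nn : ∀ a ∈ F.C, ∀ b ∈ F.C, 0 ≤ F.Q (a ::ₘ b ::ₘ eM S) := by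
    intro a ha b hb
    refine (F.limQ (cc a b)).ev (p := fun t => 0 ≤ t) ?_
    have := F.nonneg (a ::ₘ b ::ₘ 0) (by simp [ha, hb]) S 1 (fun _ => one_pos)
    rw [← F.dl_eM, ← dl_add] at this
    simpa using this
  have CC : ∀ a ∈ F.C, ∀ b ∈ F.C, F.Q (a ::ₘ a ::ₘ eM S) * F.Q (b ::ₘ b ::ₘ eM S) ≤
      F.Q (a ::ₘ b ::ₘ eM S) ^ 2 := by
    intro a ha b hb
    rcases (nn a ha a ha).eq_or_lt with h0 | h0
    · rw [← h0, zero_mul]; positivity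
    rcases (nn b hb b hb).eq_or_lt with h1 | h1
    · rw [← h1, mul_zero]; positivity
    set qa := F.Q (a ::ₘ a ::ₘ eM S)
    set qb := F.Q (b ::ₘ b ::ₘ eM S) with hqb
    set l := Real.sqrt (qa / qb) with hl
    have hl0 : 0 < l := Real.sqrt_pos.2 (div_pos h0 h1)
    have hl2 : l ^ 2 = qa / qb := Real.sq_sqrt (div_pos h0 h1).le
    have hl2' : l ^ 2 * qb = qa := by rw [hl2]; field_simp
    have h2 := mid a ha (l • b) (F.C_smul hb hl0)
    have e : (1/2 : ℝ) • (a + l • b) = (1/2 : ℝ) • a + (l / 2) • b := by module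
    have e2 := bil a b 0 l
    simp only [zero_smul, zero_add] at e2
    rw [e, bil, e2] at h2
    have h3 := nn a ha b hb
    set c := F.Q (a ::ₘ b ::ₘ eM S)
    have h4 : qa * qa ≤ ((2 * qa + 2 * l * c) / 4) ^ 2 := by
      calc qa * qa = qa * (0 ^ 2 * qa + 2 * 0 * l * c + l ^ 2 * qb) := by rw [hl2']; ring
        _ ≤ _ := h2
        _ = _ := by
          have : (l / 2) ^ 2 * F.Q (b ::ₘ b ::ₘ eM S) = qa / 4 := by rw [← hl2']; ring
          rw [this]; ring
    have h5 : qa ≤ (2 * qa + 2 * l * c) / 4 := by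
      apply le_of_sq_le_sq _ (by positivity)
      rw [sq]; exact h4
    have h6 : qa ≤ l * c := by linarith
    have h7 : qa ^ 2 ≤ (l * c) ^ 2 := by gcongr
    rw [mul_pow, hl2] at h7
    have h8 : qa * (qa * qb) ≤ qa * c ^ 2 := by
      have := mul_le_mul_of_nonneg_right h7 h1.le
      have e9 : qa / qb * c ^ 2 * qb = qa * c ^ 2 := by field_simp
      nlinarith
    exact le_of_mul_le_mul_left h8 h0
  obtain ⟨N, hN⟩ := F.C_big hw x
  have h1 := CC _ (hN N le_rfl) w hw
  have e1 := bil w x N 1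
  rw [one_smul] at e1
  rw [e1, F.Q_add _ _ _ (cc1 _), F.Q_smul _ _ _ (cc1 _), Multiset.cons_swap w x] at h1
  nlinarith

noncomputable def toAF : AF n J where
  D := F.D
  C := F.C
  U := LinearMap.range F.U
  Q := F.Q
  add := F.Q_add
  smul := F.Q_smul
  inv := by rintro s _ ⟨a, rfl⟩ hs; exact F.Q_inv s a hs
  down := fun S T h h' => F.down h h'
  van := F.Q_van
  pos := F.Q_pos
  norm := fun h hh S hS => by
    obtain ⟨a, h1, h2⟩ := F.norm hh hS
    exact ⟨_, ⟨a, rfl⟩, h1, h2⟩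
  intp := fun x S hS => by
    obtain ⟨a, h1⟩ := F.intp x hS
    exact ⟨_, ⟨a, rfl⟩, h1⟩
  ext := fun S hS hc => F.ext hS hc
  conn := fun S hS hc T j hj k hk h1 h2 h3 h4 => F.conn hS hc T hj hk h1 h2 h3 h4
  base := fun S _ hc w hw x => F.base S hc w hw x

end Fan

end AFx


namespace AFx
namespace Fan

variable {n : ℕ} {J : Type*} [Fintype J] [DecidableEq J] (F : Fan n J)

lemma Q_binom (x y : J → ℝ) (k : ℕ) : ∀ s, k + Multiset.card s = n →
    F.Q (Multiset.replicate k (x + y) + s) = ∑ ij ∈ antidiagonal k,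
      (k.choose ij.1) • F.Q (Multiset.replicate ij.1 x + (Multiset.replicate ij.2 y + s)) := by
  induction k with
  | zero => intro s hs; simp
  | succ k ih =>
    intro s hs
    rw [sum_antidiagonal_choose_succ_nsmul
      (fun i j => F.Q (Multiset.replicate i x + (Multiset.replicate j y + s))),
      Multiset.replicate_succ, Multiset.cons_add, F.Q_add]
    · rw [← Multiset.add_cons, ← Multiset.add_cons, ih _ (by simp; omega), ih _ (by simp; omega),
        add_comm]
      congr 1
      · apply sum_congr rfl
        intro ij hij
        rw [Multiset.replicate_succ, Multiset.add_cons, Multiset.cons_add]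
      · apply sum_congr rfl
        intro ij hij
        rw [Multiset.replicate_succ, Multiset.add_cons, Multiset.add_cons, Multiset.cons_add]
        congr 1
        exact Nat.choose_symm_of_eq_add (mem_antidiagonal.1 hij).symm
    · simp; omega

lemma dl_finsum {V ι : Type*} [AddCommGroup V] (w : Multiset V) (t : Finset ι) (c : ι → ℕ)
    (g : ι → V → ℝ) :
    dl w (fun x => ∑ i ∈ t, c i • g i x) = fun x => ∑ i ∈ t, c i • dl w (g i) x := by
  induction w using Multiset.induction_on with
  | empty => rfl
  | cons a w ih =>
    simp only [dl_cons, ih]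
    funext x
    simp only [fd, ← sum_sub_distrib, smul_sub]

lemma dl_Qpow (k : ℕ) : ∀ s, k + Multiset.card s = n → ∀ w : Multiset (J → ℝ),
    (Multiset.card w = k → dl w (fun x => F.Q (Multiset.replicate k x + s)) =
      fun _ => (k.factorial : ℝ) * F.Q (w + s)) ∧
    (k < Multiset.card w → dl w (fun x => F.Q (Multiset.replicate k x + s)) = fun _ => 0) := by
  induction k using Nat.strong_induction_on with
  | _ k ih =>
    intro s hs w
    have hfd : ∀ y, fd y (fun x => F.Q (Multiset.replicate k x + s)) = fun x =>
        ∑ j ∈ range k, (k.choose j) •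
          F.Q (Multiset.replicate j x + (Multiset.replicate (k - j) y + s)) := by
      intro y
      funext x
      simp only [fd]
      rw [F.Q_binom x y k s hs, Nat.sum_antidiagonal_eq_sum_range_succ (fun i j =>
        k.choose i • F.Q (Multiset.replicate i x + (Multiset.replicate j y + s))), sum_range_succ]
      simp
    have hz : ∀ w, k < Multiset.card w →
        dl w (fun x => F.Q (Multiset.replicate k x + s)) = fun _ => 0 := by
      intro w
      induction w using Multiset.induction_on with
      | empty => simp
      | cons y w _ =>
        intro hw
        rw [Multiset.card_cons] at hw
        rw [dl_cons', hfd, dl_finsum w (range k) (fun j => k.choose j)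
          (fun j x => F.Q (Multiset.replicate j x + (Multiset.replicate (k - j) y + s)))]
        funext x
        apply sum_eq_zero
        intro j hj
        rw [mem_range] at hj
        rw [(ih j hj _ (by simp; omega) w).2 (by omega)]
        simp
    refine ⟨?_, hz w⟩
    induction w using Multiset.induction_on with
    | empty =>
      intro hw
      simp at hw
      subst hw
      simp
    | cons y w _ =>
      intro hw
      rw [Multiset.card_cons] at hw
      rw [dl_cons', hfd, dl_finsum w (range k) (fun j => k.choose j)
          (fun j x => F.Q (Multiset.replicate j x + (Multiset.replicate (k - j) y + s)))]
      funext x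
      subst hw
      rw [sum_range_succ, sum_eq_zero, zero_add]
      · rw [(ih _ (Nat.lt_succ_self _) _ (by simp; omega) w).1 rfl]
        simp [Nat.factorial_succ, mul_assoc]
      · intro j hj
        rw [mem_range] at hj
        rw [(ih j (by omega) _ (by simp; omega) w).2 (by omega)]
        simp

lemma dl_ray (g : (J → ℝ) → ℝ) (x : J → ℝ) (φ : ℝ → ℝ) (h : ∀ t, 0 < t → g (t • x) = φ t) (k : ℕ) :
    ∀ t, 0 < t → dl (Multiset.replicate k x) g (t • x) = (fwdDiff 1)^[k] φ t := by
  induction k with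
  | zero => simpa using h
  | succ k ih =>
    intro t ht
    rw [Multiset.replicate_succ, dl_cons, Function.iterate_succ_apply']
    simp only [fd, fwdDiff]
    rw [ih t ht, ← ih (t + 1) (by linarith), add_smul, one_smul]

lemma f_smul {t : ℝ} (ht : 0 < t) (x) : F.f (t • x) = t ^ n * F.f x := by
  unfold f
  rw [F.P_smul ht, measureReal_def, Measure.addHaar_smul, ENNReal.toReal_mul, measureReal_def]
  simp [abs_of_pos ht, ht.le]

lemma f_eq {x} (hx : x ∈ F.C) : F.Q (Multiset.replicate n x) = n.factorial * F.f x := by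
  have h1 := F.limQ (w := Multiset.replicate n x) (by simp) x hx 0
  obtain ⟨m, hm, hm0⟩ := (h1.and (Filter.eventually_gt_atTop 0)).exists
  rw [← hm, add_zero, dl_ray F.f x (fun t => F.f x • t ^ n) (fun t ht => by
    rw [F.f_smul ht, smul_eq_mul, mul_comm]) n _ (by exact_mod_cast hm0)]
  have := fwdDiff_iter_const_smul (h := (1:ℝ)) (F.f x) (fun t : ℝ => t ^ n) n
  have e : (fun t : ℝ => F.f x • t ^ n) = F.f x • (fun t : ℝ => t ^ n) := rfl
  rw [e, this, fwdDiff_iter_eq_factorial]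
  simp [mul_comm]

lemma dl_powerset {ι V : Type*} [DecidableEq ι] [AddCommGroup V] (T : Finset ι) (v : ι → V)
    (g : V → ℝ) : ∀ h, dl (T.val.map v) g h =
      ∑ S ∈ T.powerset, (-1 : ℝ) ^ (T.card - S.card) * g (h + ∑ i ∈ S, v i) := by
  induction T using Finset.induction_on with
  | empty => simp
  | insert a T ha ih =>
    intro h
    rw [insert_val_of_notMem ha, Multiset.map_cons, dl_cons, sum_powerset_insert ha]
    simp only [fd]
    rw [ih, ih, add_comm (∑ _ ∈ _, _), sub_eq_add_neg, ← sum_neg_distrib]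
    congr 1
    · apply sum_congr rfl
      intro S hS
      have : a ∉ S := fun h => ha (mem_powerset.1 hS h)
      rw [card_insert_of_notMem ha, card_insert_of_notMem this, sum_insert this, add_assoc]
      congr 2; omega
    · apply sum_congr rfl
      intro S hS
      have := card_le_card (mem_powerset.1 hS)
      rw [card_insert_of_notMem ha, Nat.succ_sub this, pow_succ]
      ring

lemma P_sum {ι : Type*} {S : Finset ι} (hS : S.Nonempty) (v : ι → J → ℝ) (hv : ∀ i, v i ∈ F.C) :
    ∑ i ∈ S, v i ∈ F.C ∧ F.P (∑ i ∈ S, v i) = ∑ i ∈ S, F.P (v i) := by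
  classical
  induction hS using Finset.Nonempty.cons_induction with
  | singleton a => simp [hv]
  | cons a S ha hS ih =>
    rw [sum_cons, sum_cons]
    exact ⟨F.C_add (hv _) ih.1, by rw [F.P_add (hv _) ih.1, ih.2]⟩

lemma MV_eq (hn : 1 ≤ n) (v : Fin n → J → ℝ) (hv : ∀ i, v i ∈ F.C) :
    MV n (fun i => F.P (v i)) = F.Q (univ.val.map v) := by
  have h1 := (F.dl_Qpow n 0 (by simp) (univ.val.map v)).1 (by simp)
  have h2 := dl_powerset univ v (fun x => F.Q (Multiset.replicate n x + 0)) 0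
  rw [h1, sum_powerset] at h2
  simp only [add_zero, zero_add, card_univ, Fintype.card_fin] at h2
  rw [range_eq_Ico, sum_eq_sum_Ico_succ_bot (by omega)] at h2
  have h0 : F.Q (Multiset.replicate n 0) = 0 := by
    obtain ⟨m, rfl⟩ := Nat.exists_eq_add_of_le' hn
    have := F.Q_smul (Multiset.replicate m 0) 0 0 (by simp)
    rw [Multiset.replicate_succ]
    simpa using this
  simp only [powersetCard_zero, sum_singleton, sum_empty, h0, mul_zero, zero_add] at h2
  have h3 : (n.factorial : ℝ) ≠ 0 := by positivity
  apply mul_left_cancel₀ h3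
  rw [h2]
  unfold MV
  rw [mul_sum]
  have : Finset.Icc 1 n = Finset.Ico 1 (n + 1) := by ext; simp
  rw [this]
  apply sum_congr rfl
  intro j hj
  rw [mem_Ico] at hj
  rw [mul_sum, mul_sum]
  apply sum_congr rfl
  intro S hS
  rw [mem_powersetCard] at hS
  have hSn : S.Nonempty := card_pos.1 (by omega)
  have hP := F.P_sum hSn v hv
  rw [F.f_eq hP.1, hS.2]
  unfold f vol
  rw [hP.2, measureReal_def]
  ring

lemma Dempty : F.D ∅ := by
  obtain ⟨S, hS, -⟩ := F.cover 0
  exact ⟨S, hS, empty_subset _⟩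

lemma conc (c : ℕ → ℝ) (n : ℕ) (hpos : ∀ k ≤ n, 0 < c k)
    (hc : ∀ k, k + 2 ≤ n → c k * c (k + 2) ≤ c (k + 1) ^ 2) (q p : ℕ) (hqp : q ≤ p) (hpn : p ≤ n) :
    c p ^ q * c 0 ^ (p - q) ≤ c q ^ p := by
  -- step : c (k+1)^k * c 0 ≤ c k ^ (k+1)
  have step : ∀ k, k + 1 ≤ n → c (k + 1) ^ k * c 0 ≤ c k ^ (k + 1) := by
    intro k
    induction k with
    | zero => intro h; simp
    | succ k ih =>
      intro h
      have h1 := ih (by omega)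
      have h2 := hc k (by omega)
      have p0 := hpos k (by omega)
      have p1 := hpos (k + 1) (by omega)
      have p2 := hpos (k + 2) (by omega)
      have h3 : (c k * c (k + 2)) ^ (k + 1) ≤ (c (k + 1) ^ 2) ^ (k + 1) := by gcongr
      have p3 := hpos 0 (by omega)
      rw [mul_pow] at h3
      have h4 : c (k + 1) ^ k * c 0 * c (k + 2) ^ (k + 1) ≤ (c (k + 1) ^ 2) ^ (k + 1) :=
        le_trans (by gcongr) h3
      have h5 : c (k + 1) ^ k * (c (k + 2) ^ (k + 1) * c 0) ≤ c (k + 1) ^ k * c (k + 1) ^ (k + 2) := by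
        calc _ = c (k + 1) ^ k * c 0 * c (k + 2) ^ (k + 1) := by ring
          _ ≤ _ := h4
          _ = _ := by ring
      exact le_of_mul_le_mul_left h5 (by positivity)
  obtain ⟨d, rfl⟩ := Nat.exists_eq_add_of_le hqp
  rw [Nat.add_sub_cancel_left]
  clear hqp
  induction d with
  | zero => simp
  | succ d ih =>
    have h1 := ih (by omega)
    have h2 := step (q + d) (by omega)
    have p1 := hpos (q + d) (by omega)
    have p2 := hpos (q + d + 1) (by omega)
    have p3 := hpos 0 (by omega)
    have p4 := hpos q (by omega)
    rw [← add_assoc]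
    rcases Nat.eq_zero_or_pos (q + d) with h0 | h0
    · have : q = 0 := by omega
      have : d = 0 := by omega
      subst_vars
      simp
    have h3 : (c (q + d + 1) ^ (q + d) * c 0) ^ q ≤ (c (q + d) ^ (q + d + 1)) ^ q := by gcongr
    have h4 : (c (q + d) ^ q * c 0 ^ d) ^ (q + d + 1) ≤ (c q ^ (q + d)) ^ (q + d + 1) := by gcongr
    refine le_of_pow_le_pow_left₀ h0.ne' (by positivity) ?_
    calc (c (q + d + 1) ^ q * c 0 ^ (d + 1)) ^ (q + d)
        = (c (q + d + 1) ^ (q + d) * c 0) ^ q * c 0 ^ (d * (q + d + 1)) := by ring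
      _ ≤ (c (q + d) ^ (q + d + 1)) ^ q * c 0 ^ (d * (q + d + 1)) := by gcongr
      _ = (c (q + d) ^ q * c 0 ^ d) ^ (q + d + 1) := by ring
      _ ≤ (c q ^ (q + d)) ^ (q + d + 1) := h4
      _ = _ := by ring

lemma map_if (a b : J → ℝ) (k : ℕ) (hk : k ≤ n) :
    (univ : Finset (Fin n)).val.map (fun j : Fin _ => if (j : ℕ) < k then a else b) =
      Multiset.replicate k a + Multiset.replicate (n - k) b := by
  obtain ⟨m, rfl⟩ := Nat.exists_eq_add_of_le hk
  rw [Nat.add_sub_cancel_left]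
  have : (univ : Finset (Fin (k + m))).val.map (fun j : Fin _ => if (j : ℕ) < k then a else b) =
      (Multiset.range (k + m)).map (fun j => if j < k then a else b) := by
    have e : Multiset.range (k + m) = (univ : Finset (Fin (k + m))).val.map (fun j : Fin _ => (j : ℕ)) := by
      have := congrArg Finset.val (Fin.map_valEmbedding_univ (n := k + m))
      rw [Nat.Iio_eq_range] at this
      exact this.symm
    rw [e, Multiset.map_map]; rfl
  rw [this, Multiset.range_add, Multiset.map_add]
  congr 1
  · rw [Multiset.eq_replicate]
    refine ⟨by simp, fun x hx => ?_⟩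
    obtain ⟨j, hj, rfl⟩ := Multiset.mem_map.1 hx
    rw [if_pos (Multiset.mem_range.1 hj)]
  · rw [Multiset.eq_replicate]
    refine ⟨by simp, fun x hx => ?_⟩
    obtain ⟨j, hj, rfl⟩ := Multiset.mem_map.1 hx
    obtain ⟨i, -, rfl⟩ := Multiset.mem_map.1 hj
    rw [if_neg (by omega)]

lemma final {p q : ℕ} (hq : 1 ≤ q) (hqp : q ≤ p) (hpn : p ≤ n) {a b} (ha : a ∈ F.C) (hb : b ∈ F.C) :
    MV n (fun j => if (j : ℕ) < q then F.P a else F.P b) ^ p ≥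
      MV n (fun j => if (j : ℕ) < p then F.P a else F.P b) ^ q *
        ((n.factorial : ℝ) * vol (F.P b)) ^ (p - q) := by
  set c : ℕ → ℝ := fun k => F.Q (Multiset.replicate k a + Multiset.replicate (n - k) b) with hcdef
  have hMV : ∀ k ≤ n, MV n (fun j => if (j : ℕ) < k then F.P a else F.P b) = c k := by
    intro k hk
    have := F.MV_eq (by omega) (fun j => if (j : ℕ) < k then a else b)
      (fun i => by split_ifs <;> assumption)
    rw [map_if _ _ _ hk] at this
    simp only [hcdef]
    rw [← this]
    congr 1
    funext j
    split_ifs <;> rfl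
  have h0 : (n.factorial : ℝ) * vol (F.P b) = c 0 := by
    have := F.f_eq hb
    simp only [hcdef]
    simp only [Multiset.replicate_zero, zero_add, Nat.sub_zero]
    rw [this]; rfl
  rw [hMV q (by omega), hMV p hpn, h0]
  refine conc c n ?_ ?_ q p hqp hpn
  · intro k hk
    have := F.toAF.posC (Multiset.replicate k a + Multiset.replicate (n - k) b) ∅ F.Dempty
      (by simp; omega) (by
        intro v hv
        rcases Multiset.mem_add.1 hv with h | h
        · rw [Multiset.eq_of_mem_replicate h]; exact ha
        · rw [Multiset.eq_of_mem_replicate h]; exact hb)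
    have e0 : eM (∅ : Finset J) = 0 := rfl
    rw [e0, add_zero] at this
    exact this
  · intro k hk
    have := F.toAF.main (Multiset.replicate k a + Multiset.replicate (n - (k + 2)) b) ∅ F.Dempty
      (by simp; omega) (by
        intro v hv
        rcases Multiset.mem_add.1 hv with h | h
        · rw [Multiset.eq_of_mem_replicate h]; exact ha
        · rw [Multiset.eq_of_mem_replicate h]; exact hb) b hb a
    have e1 : n - k = n - (k + 2) + 1 + 1 := by omega
    have e2 : n - (k + 1) = n - (k + 2) + 1 := by omega
    have e0 : eM (∅ : Finset J) = 0 := rfl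
    rw [e0, add_zero, mul_comm] at this
    simp only [hcdef]
    rw [e1, e2]
    simp only [Multiset.replicate_succ, Multiset.add_cons, Multiset.cons_add]
    rw [Multiset.cons_swap b a] 
    exact this

end Fan
end AFx


namespace AFx

/-- Fourier–Motzkin: finitely generated cones are polyhedral -/
lemma fm {V : Type*} [AddCommGroup V] [Module ℝ V] [FiniteDimensional ℝ V] (G : Finset V) :
    ∃ s : Finset (V →ₗ[ℝ] ℝ), (∀ a ∈ s, ∀ g ∈ G, a g ≤ 0) ∧ ∀ x, (∀ a ∈ s, a x ≤ 0) →
      ∃ w : V → ℝ, (∀ g ∈ G, 0 ≤ w g) ∧ x = ∑ g ∈ G, w g • g := by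
  classical
  induction G using Finset.induction_on with
  | empty =>
    let b := Module.finBasis ℝ V
    refine ⟨univ.image (fun i => b.coord i) ∪ univ.image (fun i => - b.coord i), by simp, ?_⟩
    intro x hx
    refine ⟨0, by simp, ?_⟩
    rw [sum_empty]
    apply b.ext_elem
    intro i
    have h1 := hx (b.coord i) (by simp)
    have h2 := hx (-b.coord i) (by simp)
    simp at h1 h2 ⊢
    linarith
  | insert g G hg ih =>
    obtain ⟨s, h1, h2⟩ := ih
    refine ⟨(s.filter fun a => a g ≤ 0) ∪
      ((s.filter fun a => 0 < a g) ×ˢ (s.filter fun a => a g ≤ 0)).image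
        (fun p => (- p.2 g) • p.1 + (p.1 g) • p.2), ?_, ?_⟩
    · intro a ha k hk
      rcases mem_union.1 ha with ha | ha
      · rw [mem_filter] at ha
        rcases mem_insert.1 hk with rfl | hk
        exacts [ha.2, h1 a ha.1 k hk]
      · obtain ⟨⟨p, q⟩, hp, rfl⟩ := mem_image.1 ha
        simp only [mem_product, mem_filter] at hp
        simp only [LinearMap.add_apply, LinearMap.smul_apply, smul_eq_mul]
        rcases mem_insert.1 hk with rfl | hk
        · nlinarith
        · have := h1 p hp.1.1 k hk
          have := h1 q hp.2.1 k hk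
          nlinarith [hp.1.2, hp.2.2]
    · intro x hx
      have hn : ∀ a ∈ s, a g ≤ 0 → a x ≤ 0 := fun a ha hag =>
        hx a (mem_union_left _ (mem_filter.2 ⟨ha, hag⟩))
      have hpn : ∀ p ∈ s, 0 < p g → ∀ q ∈ s, q g ≤ 0 → (- q g) * p x + p g * q x ≤ 0 := by
        intro p hp hpg q hq hqg
        have := hx _ (mem_union_right _ (mem_image.2 ⟨(p, q),
          mem_product.2 ⟨mem_filter.2 ⟨hp, hpg⟩, mem_filter.2 ⟨hq, hqg⟩⟩, rfl⟩))
        simpa using this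
      have ht : ∃ t : ℝ, 0 ≤ t ∧ ∀ a ∈ s, a x ≤ t * a g := by
        by_cases hpos : ∃ p ∈ s, 0 < p g ∧ 0 < p x
        · obtain ⟨p0, hp0, hp0g, hp0x⟩ := hpos
          obtain ⟨p, hp, hmax⟩ := exists_max_image (s.filter fun a => 0 < a g)
            (fun a => a x / a g) ⟨p0, mem_filter.2 ⟨hp0, hp0g⟩⟩
          rw [mem_filter] at hp
          have hpx : 0 < p x / p g := lt_of_lt_of_le (div_pos hp0x hp0g)
            (hmax p0 (mem_filter.2 ⟨hp0, hp0g⟩))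
          refine ⟨p x / p g, hpx.le, fun a ha => ?_⟩
          rcases lt_or_ge 0 (a g) with hag | hag
          · exact (div_le_iff₀ hag).1 (hmax a (mem_filter.2 ⟨ha, hag⟩))
          · have := hpn p hp.1 hp.2 a ha hag
            rw [div_mul_eq_mul_div, le_div_iff₀ hp.2]
            linarith
        · push Not at hpos
          refine ⟨0, le_rfl, fun a ha => ?_⟩
          rw [zero_mul]
          rcases lt_or_ge 0 (a g) with hag | hag
          exacts [hpos a ha hag, hn a ha hag]
      obtain ⟨t, ht0, ht⟩ := ht
      obtain ⟨w, hw, hxw⟩ := h2 (x - t • g) (fun a ha => by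
        have := ht a ha
        simp only [map_sub, map_smul, smul_eq_mul]
        linarith)
      refine ⟨Function.update w g t, ?_, ?_⟩
      · intro k hk
        rcases mem_insert.1 hk with rfl | hk
        · simpa
        · have : k ≠ g := fun h => hg (h ▸ hk)
          simpa [this] using hw k hk
      · rw [sum_insert hg, Function.update_self]
        have : ∑ k ∈ G, Function.update w g t k • k = ∑ k ∈ G, w k • k := by
          apply sum_congr rfl
          intro k hk
          have : k ≠ g := fun h => hg (h ▸ hk)
          rw [Function.update_of_ne this]
        rw [this, ← hxw]; abel

lemma fm2 {V : Type*} [AddCommGroup V] [Module ℝ V] [FiniteDimensional ℝ V] (G : Finset V) :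
    ∃ s : Finset (V →ₗ[ℝ] ℝ), ∀ x, (∀ a ∈ s, ∃ g ∈ G, a x ≤ a g) → x ∈ convexHull ℝ (G : Set V) := by
  classical
  obtain ⟨s, h1, h2⟩ := fm (G.image fun g => (g, (1 : ℝ)))
  refine ⟨s.image fun a => a ∘ₗ LinearMap.inl ℝ V ℝ, fun x hx => ?_⟩
  obtain ⟨w, hw, hxw⟩ := h2 (x, 1) (fun a ha => by
    obtain ⟨g, hg, hag⟩ := hx _ (mem_image_of_mem _ ha)
    have h3 := h1 a ha (g, 1) (mem_image_of_mem _ hg)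
    have e : ∀ y : V, a (y, 1) = a (y, 0) + a (0, 1) := by
      intro y; rw [← map_add]; simp
    simp only [LinearMap.comp_apply, LinearMap.inl_apply] at hag
    rw [e] at h3 ⊢
    linarith)
  rw [sum_image (by intro a _ b _ h; exact (Prod.mk.inj h).1)] at hxw
  rw [Finset.mem_convexHull']
  refine ⟨fun g => w (g, 1), fun g hg => hw _ (mem_image_of_mem _ hg), ?_, ?_⟩
  · have := congrArg Prod.snd hxw
    simp [Prod.snd_sum] at this
    exact this.symm
  · have := congrArg Prod.fst hxw
    simp [Prod.fst_sum] at this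
    exact this.symm

/-- finite outer approximation -/
lemma outer {n : ℕ} {K : Set (Fin n → ℝ)} (hne : K.Nonempty) (hc : IsCompact K) (hcv : Convex ℝ K)
    {ε : ℝ} (hε : 0 < ε) : ∃ G : Finset (Fin n → ℝ), G.Nonempty ∧ K ⊆ convexHull ℝ (G : Set _) ∧
      convexHull ℝ (G : Set (Fin n → ℝ)) ⊆ Metric.cthickening ε K := by
  classical
  obtain ⟨t, htK, htf, hcov⟩ := hc.finite_cover_balls hε
  set W : Set (Fin n → ℝ) := Set.pi Set.univ fun _ => ({-ε, ε} : Set ℝ) with hW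
  have hWf : W.Finite := Set.Finite.pi fun _ => (Set.finite_singleton ε).insert _
  have hWc : convexHull ℝ W = Metric.closedBall 0 ε := by
    rw [hW, convexHull_pi]
    ext x
    rw [mem_closedBall_zero_iff, pi_norm_le_iff_of_nonneg hε.le]
    simp only [Set.mem_pi, Set.mem_univ, true_imp_iff, convexHull_pair,
      segment_eq_Icc (by linarith : -ε ≤ ε), Real.norm_eq_abs, abs_le, Set.mem_Icc]
  have hcoe : ((htf.add hWf).toFinset : Set (Fin n → ℝ)) = t + W := by simp
  have hconv : convexHull ℝ ((htf.add hWf).toFinset : Set (Fin n → ℝ)) =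
      convexHull ℝ t + Metric.closedBall 0 ε := by rw [hcoe, convexHull_add, hWc]
  refine ⟨(htf.add hWf).toFinset, ?_, ?_, ?_⟩
  · rw [← Finset.coe_nonempty, ← convexHull_nonempty_iff (𝕜 := ℝ), hconv]
    refine Set.Nonempty.add ?_ ⟨0, by simp [hε.le]⟩
    rw [convexHull_nonempty_iff]
    obtain ⟨x, hx⟩ := hne
    have := hcov hx
    simp only [Set.mem_iUnion] at this
    obtain ⟨y, hy, _⟩ := this
    exact ⟨y, hy⟩
  · rw [hconv]
    intro x hx
    have := hcov hx
    simp only [Set.mem_iUnion] at this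
    obtain ⟨y, hy, hxy⟩ := this
    refine ⟨y, subset_convexHull _ _ hy, x - y, ?_, by simp⟩
    rw [mem_closedBall_zero_iff, ← dist_eq_norm]
    exact (Metric.mem_ball.1 hxy).le
  · rw [hconv]
    rintro _ ⟨y, hy, z, hz, rfl⟩
    have hyK : y ∈ K := convexHull_min htK hcv hy
    refine Metric.mem_cthickening_of_dist_le _ y _ _ hyK ?_
    simpa [dist_eq_norm] using hz

end AFx


namespace AFx

section construct
variable {n : ℕ} {J : Type*} [Fintype J] [DecidableEq J] (u : J → (Fin n → ℝ) →ₗ[ℝ] ℝ)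

lemma dense_ne {V : Type*} [Fintype V] (φ : (V → ℝ) →ₗ[ℝ] ℝ) (hφ : φ ≠ 0) :
    Dense {h | φ h ≠ 0} := by
  obtain ⟨y, hy⟩ : ∃ y, φ y ≠ 0 := by
    by_contra! hc
    exact hφ (LinearMap.ext hc)
  intro x
  by_cases hx : φ x = 0
  · have h1 : Filter.Tendsto (fun m : ℕ => x + ((1 : ℝ) / (m + 1)) • y) Filter.atTop
        (nhds (x + (0 : ℝ) • y)) :=
      tendsto_const_nhds.add (tendsto_one_div_add_atTop_nhds_zero_nat.smul_const y)
    rw [zero_smul, add_zero] at h1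
    refine mem_closure_of_tendsto h1 (Filter.Eventually.of_forall fun m => ?_)
    simp only [Set.mem_setOf_eq, map_add, map_smul, hx, zero_add, smul_eq_mul]
    exact mul_ne_zero (by positivity) hy
  · exact subset_closure hx

lemma generic : ∃ G : Set (J → ℝ), Dense G ∧ ∀ h ∈ G, ∀ T : Finset J, ∀ x,
    (∀ j ∈ T, u j x = h j) → LinearIndependent ℝ (fun i : T => u i) := by
  have h1 : ∀ T : Finset J, ∃ O : Set (J → ℝ), IsOpen O ∧ Dense O ∧ ∀ h ∈ O, ∀ x,
      (∀ j ∈ T, u j x = h j) → LinearIndependent ℝ (fun i : T => u i) := by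
    intro T
    by_cases hT : LinearIndependent ℝ (fun i : T => u i)
    · exact ⟨Set.univ, isOpen_univ, dense_univ, fun _ _ _ _ => hT⟩
    · obtain ⟨g, hg, i, hi⟩ := Fintype.not_linearIndependent_iff.1 hT
      let φ : (J → ℝ) →ₗ[ℝ] ℝ := ∑ k : T, g k • LinearMap.proj (k : J)
      have hφ : ∀ h, φ h = ∑ k : T, g k * h k := by intro h; simp [φ]
      refine ⟨{h | φ h ≠ 0}, ?_, dense_ne φ ?_, ?_⟩
      · exact isOpen_ne_fun (LinearMap.continuous_of_finiteDimensional φ) continuous_const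
      · intro h0
        apply hi
        have := hφ (Pi.single (i : J) 1)
        rw [h0, sum_eq_single i] at this
        · simpa using this.symm
        · intro k _ hk
          rw [Pi.single_eq_of_ne (fun h => hk (Subtype.ext h)), mul_zero]
        · simp
      · intro h hh x hx
        exfalso
        apply hh
        rw [hφ]
        have := LinearMap.congr_fun hg x
        simp only [LinearMap.sum_apply, LinearMap.smul_apply, smul_eq_mul, LinearMap.zero_apply] at this
        rw [← this]
        exact sum_congr rfl fun k _ => by rw [hx k k.2]
  choose O ho hd hO using h1
  exact ⟨⋂ T, O T, dense_iInter_of_isOpen ho hd, fun h hh T x hx =>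
    hO T h (Set.mem_iInter.1 hh T) x hx⟩

lemma exX (S : Finset J) : ∃ Y : (J → ℝ) →ₗ[ℝ] (Fin n → ℝ), (∀ x, (∀ i ∈ S, u i x = 0) → x = 0) →
    ∀ x h, (∀ i ∈ S, u i x = h i) → Y h = x := by
  by_cases hS : ∀ x, (∀ i ∈ S, u i x = 0) → x = 0
  · let R : (Fin n → ℝ) →ₗ[ℝ] (S → ℝ) := LinearMap.pi fun i => u i
    have hR : LinearMap.ker R = ⊥ := by
      rw [LinearMap.ker_eq_bot']
      intro x hx
      exact hS x fun i hi => congrFun hx ⟨i, hi⟩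
    obtain ⟨g, hg⟩ := R.exists_leftInverse_of_injective hR
    refine ⟨g ∘ₗ LinearMap.pi fun i : S => LinearMap.proj (i : J), fun _ x h hx => ?_⟩
    have e : (LinearMap.pi fun i : S => LinearMap.proj (R := ℝ) (φ := fun _ : J => ℝ) (i : J)) h = R x := by
      funext i
      simp [R, hx i i.2]
    rw [LinearMap.comp_apply, e]
    exact LinearMap.congr_fun hg x
  · exact ⟨0, fun h => absurd h hS⟩

lemma exSol {S : Finset J} (hc : S.card = n) (hS : ∀ x, (∀ i ∈ S, u i x = 0) → x = 0) (h : J → ℝ) :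
    ∃ x, ∀ i ∈ S, u i x = h i := by
  let R : (Fin n → ℝ) →ₗ[ℝ] (S → ℝ) := LinearMap.pi fun i => u i
  have hR : Function.Injective R := by
    rw [← LinearMap.ker_eq_bot, LinearMap.ker_eq_bot']
    intro x hx
    exact hS x fun i hi => congrFun hx ⟨i, hi⟩
  have := (LinearMap.injective_iff_surjective_of_finrank_eq_finrank (f := R) (by simp [hc])).1 hR
  obtain ⟨x, hx⟩ := this fun i => h i
  exact ⟨x, fun i hi => congrFun hx ⟨i, hi⟩⟩

lemma card_n {S : Finset J} (hS : ∀ x, (∀ i ∈ S, u i x = 0) → x = 0)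
    (hl : LinearIndependent ℝ (fun i : S => u i)) : S.card = n := by
  apply le_antisymm
  · have := hl.fintype_card_le_finrank
    have e : Module.finrank ℝ ((Fin n → ℝ) →ₗ[ℝ] ℝ) = n := by
      rw [Module.finrank_linearMap]; simp
    rw [e] at this
    simpa using this
  · let R : (Fin n → ℝ) →ₗ[ℝ] (S → ℝ) := LinearMap.pi fun i => u i
    have hR : Function.Injective R := by
      rw [← LinearMap.ker_eq_bot, LinearMap.ker_eq_bot']
      intro x hx
      exact hS x fun i hi => congrFun hx ⟨i, hi⟩
    have := LinearMap.finrank_le_finrank_of_injective hR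
    simpa using this

lemma small {h : J → ℝ} {x d : Fin n → ℝ} (hx : ∀ j, u j x ≤ h j)
    (hd : ∀ j, u j x = h j → u j d ≤ 0) : ∃ s : ℝ, 0 < s ∧ ∀ j, u j (x + s • d) ≤ h j := by
  have : ∀ j, ∀ᶠ s in nhdsWithin (0 : ℝ) (Set.Ioi 0), u j (x + s • d) ≤ h j := by
    intro j
    rcases (hx j).eq_or_lt with he | hl
    · filter_upwards [self_mem_nhdsWithin] with s hs
      rw [map_add, map_smul, smul_eq_mul, he]
      have := hd j he
      have hs : (0:ℝ) < s := hs
      nlinarith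
    · have hc : Continuous fun s : ℝ => u j (x + s • d) := by
        simp only [map_add, map_smul]; fun_prop
      have h0 : u j (x + (0:ℝ) • d) < h j := by simpa using hl
      have := (hc.tendsto 0).eventually_lt_const h0
      exact (this.filter_mono nhdsWithin_le_nhds).mono fun s hs => hs.le
  obtain ⟨s, h1, h2⟩ := ((Filter.eventually_all.2 this).and self_mem_nhdsWithin).exists
  exact ⟨s, h2, h1⟩

lemma vertex (h : J → ℝ) (hne : ∃ x, ∀ j, u j x ≤ h j)
    (hco : ∀ i : Fin n, (∃ j, u j = LinearMap.proj i) ∧ ∃ j, u j = - LinearMap.proj i)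
    (c : (Fin n → ℝ) →ₗ[ℝ] ℝ) : ∃ x, (∀ j, u j x ≤ h j) ∧ (∀ y, (∀ j, u j y ≤ h j) → c y ≤ c x) ∧
      ∀ d, (∀ j, u j x = h j → u j d = 0) → d = 0 := by
  have hcont : ∀ v : (Fin n → ℝ) →ₗ[ℝ] ℝ, Continuous v := fun v =>
    LinearMap.continuous_of_finiteDimensional v
  set P : Set (Fin n → ℝ) := {x | ∀ j, u j x ≤ h j} with hP
  have hcl : IsClosed P := by
    have : P = ⋂ j, {x | u j x ≤ h j} := by ext; simp [hP]
    rw [this]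
    exact isClosed_iInter fun j => isClosed_le (hcont _) continuous_const
  have hcomp : IsCompact P := by
    choose jp hjp using fun i => (hco i).1
    choose jm hjm using fun i => (hco i).2
    refine IsCompact.of_isClosed_subset (isCompact_Icc (a := fun i => - h (jm i))
      (b := fun i => h (jp i))) hcl fun x hx => ?_
    refine ⟨fun i => ?_, fun i => ?_⟩
    · have := hx (jm i)
      rw [hjm] at this
      simp at this
      linarith
    · have := hx (jp i)
      rwa [hjp] at this
  obtain ⟨m, hm, hmax⟩ := hcomp.exists_isMaxOn hne (hcont c).continuousOn
  have hmax' : ∀ y ∈ P, c y ≤ c m := fun y hy => hmax hy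
  have hF : IsCompact (P ∩ {x | c x = c m}) :=
    hcomp.inter_right (isClosed_eq (hcont c) continuous_const)
  obtain ⟨x, hx⟩ := hF.extremePoints_nonempty ⟨m, hm, rfl⟩
  rw [mem_extremePoints_iff_left] at hx
  obtain ⟨⟨hxP, hxm⟩, hext⟩ := hx
  have hxm : c x = c m := hxm
  refine ⟨x, hxP, fun y hy => by rw [hxm]; exact hmax' y hy, fun d hd => ?_⟩
  obtain ⟨s, hs, h1⟩ := small u hxP (d := d) fun j hj => (hd j hj).le
  obtain ⟨t, ht, h2⟩ := small u hxP (d := -d) fun j hj => by rw [map_neg, hd j hj, neg_zero]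
  have e1 := hmax' _ h1
  have e2 := hmax' _ h2
  rw [map_add, map_smul, smul_eq_mul, hxm] at e1
  rw [map_add, map_smul, map_neg, smul_eq_mul, hxm] at e2
  have cd : c d = 0 := by
    apply le_antisymm
    · by_contra hcon
      push Not at hcon
      nlinarith [mul_pos hs hcon]
    · by_contra hcon
      push Not at hcon
      nlinarith [mul_pos ht (neg_pos.2 hcon)]
  have := hext (x + s • d) ⟨h1, by simp [cd, hxm]⟩ (x + t • -d) ⟨h2, by simp [cd, hxm]⟩
    ⟨t / (s + t), s / (s + t), by positivity, by positivity, by field_simp; ring, by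
      have : s + t ≠ 0 := by positivity
      rw [smul_add, smul_add, add_add_add_comm, ← add_smul, smul_smul, smul_smul, smul_neg,
        ← sub_eq_add_neg, ← sub_smul]
      have e3 : t / (s + t) + s / (s + t) = 1 := by field_simp; ring
      have e4 : t / (s + t) * s - s / (s + t) * t = 0 := by ring
      rw [e3, e4]; simp⟩
  have h3 : s • d = 0 := by simpa using this
  exact (smul_eq_zero.1 h3).resolve_left hs.ne'

lemma construct (hs : J → ℝ) (hne : ∃ x, ∀ j, u j x ≤ hs j)
    (hco : ∀ i : Fin n, (∃ j, u j = LinearMap.proj i) ∧ ∃ j, u j = - LinearMap.proj i) :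
    ∃ F : Fan n J, F.u = u ∧ ∃ h0 ∈ F.C, (F.P h0).Nonempty ∧ ∀ S ∈ F.B, F.X S hs ∈ F.P hs := by
  classical
  choose X hX using exX u
  obtain ⟨G, hGd, hG⟩ := generic u
  set Z : Finset J → Set (J → ℝ) := fun S => {h | ∀ j, u j (X S h) ≤ h j} with hZ
  have hZc : ∀ S, IsClosed (Z S) := by
    intro S
    have : Z S = ⋂ j, {h | u j (X S h) ≤ h j} := by ext; simp [hZ]
    rw [this]
    refine isClosed_iInter fun j => isClosed_le ?_ (continuous_apply j)
    exact LinearMap.continuous_of_finiteDimensional (u j ∘ₗ X S)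
  set O : Set (J → ℝ) := ⋂ S : Finset J, {h | hs ∉ Z S → h ∉ Z S} with hO
  have hOo : IsOpen O := by
    refine isOpen_iInter_of_finite fun S => ?_
    by_cases hS : hs ∈ Z S
    · simp [hS]
    · simp only [hS, not_false_eq_true, true_imp_iff]
      exact (hZc S).isOpen_compl
  have hsO : hs ∈ O := by simp [hO]
  set O2 : Set (J → ℝ) := O ∩ ⋂ j, {h | hs j < h j} with hO2
  have hO2o : IsOpen O2 := hOo.inter (isOpen_iInter_of_finite fun j =>
    isOpen_lt continuous_const (continuous_apply j))
  have hO2n : O2.Nonempty := by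
    have hc : Continuous fun t : ℝ => hs + t • (1 : J → ℝ) := by fun_prop
    have h1 : ∀ᶠ t in nhds (0:ℝ), hs + t • (1 : J → ℝ) ∈ O :=
      (hc.tendsto 0).eventually (hOo.mem_nhds (by simpa using hsO))
    obtain ⟨t, h2, h3⟩ := ((h1.filter_mono nhdsWithin_le_nhds).and
      (self_mem_nhdsWithin (a := (0:ℝ)) (s := Set.Ioi 0))).exists
    refine ⟨_, h2, Set.mem_iInter.2 fun j => ?_⟩
    have h3 : (0:ℝ) < t := h3
    simp [h3]
  obtain ⟨h0, hh0, hh0G⟩ := hGd.inter_open_nonempty O2 hO2o hO2n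
  have hlt : ∀ j, hs j < h0 j := fun j => Set.mem_iInter.1 hh0.2 j
  have hne0 : ∃ x, ∀ j, u j x ≤ h0 j := by
    obtain ⟨x, hx⟩ := hne
    exact ⟨x, fun j => (hx j).trans (hlt j).le⟩
  set B : Finset (Finset J) := univ.filter fun T => ∃ x, (∀ j, u j x ≤ h0 j) ∧
    (∀ j, j ∈ T ↔ u j x = h0 j) ∧ ∀ d, (∀ j ∈ T, u j d = 0) → d = 0 with hB
  have hBi : ∀ S ∈ B, ∀ d, (∀ j ∈ S, u j d = 0) → d = 0 := by
    intro S hS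
    obtain ⟨x, -, -, h⟩ := (mem_filter.1 hS).2
    exact h
  have hBc : ∀ S ∈ B, S.card = n := by
    intro S hS
    obtain ⟨x, -, h1, h⟩ := (mem_filter.1 hS).2
    exact card_n u h (hG h0 hh0G S x fun j hj => (h1 j).1 hj)
  have hBt : ∀ S ∈ B, ∀ h, ∀ i ∈ S, u i (X S h) = h i := by
    intro S hS h i hi
    obtain ⟨x, hx⟩ := exSol u (hBc S hS) (hBi S hS) h
    rw [hX S (hBi S hS) x h hx, hx i hi]
  let F : Fan n J :=
    { u := u
      B := B
      X := X
      tight := hBt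
      inj := hBi
      card := hBc
      cover := by
        intro c
        obtain ⟨x, hx, hmax, hd⟩ := vertex u h0 hne0 hco c
        set T : Finset J := univ.filter fun j => u j x = h0 j with hT
        have hmT : ∀ j, j ∈ T ↔ u j x = h0 j := fun j => by simp [hT]
        have hTB : T ∈ B := mem_filter.2 ⟨mem_univ _, x, hx, hmT, fun d h =>
          hd d fun j hj => h j ((hmT j).2 hj)⟩
        refine ⟨T, hTB, fun j => if j ∈ T then c (X T (Pi.single j 1)) else 0, ?_, ?_⟩
        · intro j
          dsimp only
          split_ifs with hj
          · by_contra hcon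
            push Not at hcon
            obtain ⟨s, hs0, h1⟩ := small u hx (d := - X T (Pi.single j 1)) (by
              intro k hk
              rw [map_neg, hBt T hTB _ k ((hmT k).2 hk)]
              by_cases e : k = j
              · subst e; simp
              · simp [e])
            have := hmax _ h1
            rw [map_add, map_smul, map_neg, smul_eq_mul] at this
            nlinarith [mul_pos hs0 (neg_pos.2 hcon)]
          · exact le_rfl
        · intro y
          have e : X T (∑ j ∈ T, u j y • Pi.single j (1:ℝ)) = y := by
            refine hX T (hBi T hTB) y _ fun i hi => ?_
            rw [Finset.sum_apply, sum_eq_single i]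
            · simp
            · intro k _ hk
              simp [hk.symm]
            · intro h; exact absurd hi h
          conv_lhs => rw [← e]
          rw [map_sum, map_sum]
          refine sum_congr rfl fun j hj => ?_
          dsimp only
          rw [if_pos hj, map_smul, map_smul, smul_eq_mul, mul_comm]
      Cne := by
        refine ⟨h0, fun S hS j hj => ?_⟩
        obtain ⟨x, h1, h2, h3⟩ := (mem_filter.1 hS).2
        rw [hX S h3 x h0 fun i hi => (h2 i).1 hi]
        exact lt_of_le_of_ne (h1 j) fun e => hj ((h2 j).2 e) }
  refine ⟨F, rfl, h0, ?_, hne0, ?_⟩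
  · intro S hS j hj
    obtain ⟨x, h1, h2, h3⟩ := (mem_filter.1 hS).2
    change u j (X S h0) < h0 j
    rw [hX S h3 x h0 fun i hi => (h2 i).1 hi]
    exact lt_of_le_of_ne (h1 j) fun e => hj ((h2 j).2 e)
  · intro S hS
    obtain ⟨x, h1, h2, h3⟩ := (mem_filter.1 hS).2
    by_contra hcon
    have h4 : h0 ∉ Z S := Set.mem_iInter.1 hh0.1 S hcon
    apply h4
    intro j
    rw [hX S h3 x h0 fun i hi => (h2 i).1 hi]
    exact h1 j

end construct

end AFx


namespace AFx

namespace Fan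
variable {n : ℕ} {J : Type*} [Fintype J] [DecidableEq J] (F : Fan n J)

lemma side {K : Set (Fin n → ℝ)} (hcv : Convex ℝ K) {ε : ℝ} (hε : 0 < ε) {hK : J → ℝ}
    (h1 : ∀ S ∈ F.B, F.X S hK ∈ F.P hK ∩ Metric.cthickening (ε / 2) K) (h2 : K ⊆ F.P hK)
    {h0 : J → ℝ} (hh0 : h0 ∈ F.C) (hne : (F.P h0).Nonempty) :
    ∃ a ∈ F.C, K ⊆ F.P a ∧ F.P a ⊆ Metric.cthickening ε K := by
  obtain ⟨x0, hx0⟩ := hne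
  obtain ⟨M, hM⟩ : ∃ M : ℝ, ∀ S ∈ F.B, ‖F.X S h0 - x0‖ ≤ M := by
    obtain ⟨M, hM⟩ := (F.B.image fun S => ‖F.X S h0 - x0‖).bddAbove
    exact ⟨M, fun S hS => hM (by simpa using ⟨S, hS, rfl⟩)⟩
  set δ : ℝ := ε / 2 / (|M| + 1) with hδ
  have hδ0 : 0 < δ := by positivity
  have hδM : δ * M ≤ ε / 2 := by
    rw [hδ, div_mul_eq_mul_div, div_le_iff₀ (by positivity)]
    have := le_abs_self M
    nlinarith
  have hX : ∀ S ∈ F.B, F.X S (hK + δ • (h0 - F.U x0)) = F.X S hK + δ • (F.X S h0 - x0) := by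
    intro S hS
    rw [map_add, map_smul, map_sub, F.XU hS]
  refine ⟨hK + δ • (h0 - F.U x0), ?_, ?_, ?_⟩
  · intro S hS j hj
    rw [hX S hS]
    have e1 := (h1 S hS).1 j
    have e2 := hh0 S hS j hj
    simp only [map_add, map_smul, map_sub, Pi.add_apply, Pi.smul_apply, Pi.sub_apply, smul_eq_mul,
      U_apply]
    nlinarith
  · intro x hx j
    have e1 := h2 hx j
    have e2 := hx0 j
    simp only [Pi.add_apply, Pi.smul_apply, Pi.sub_apply, smul_eq_mul, U_apply]
    nlinarith
  · refine F.P_hull.trans (convexHull_min ?_ (hcv.cthickening ε))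
    rintro _ ⟨S, hS, rfl⟩
    dsimp only
    rw [hX S hS]
    have : F.X S hK + δ • (F.X S h0 - x0) ∈
        Metric.cthickening (ε / 2) (Metric.cthickening (ε / 2) K) := by
      refine Metric.mem_cthickening_of_dist_le _ _ _ _ (h1 S hS).2 ?_
      rw [dist_eq_norm, add_sub_cancel_left, norm_smul, Real.norm_of_nonneg hδ0.le]
      exact (mul_le_mul_of_nonneg_left (hM S hS) hδ0.le).trans hδM
    have := Metric.cthickening_cthickening_subset (by positivity) (by positivity) K this
    rwa [add_halves] at this

end Fan

lemma approx {n : ℕ} {K L : Set (Fin n → ℝ)}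
    (hKne : K.Nonempty) (hKc : IsCompact K) (hKcv : Convex ℝ K)
    (hLne : L.Nonempty) (hLc : IsCompact L) (hLcv : Convex ℝ L) {ε : ℝ} (hε : 0 < ε) :
    ∃ (J : Type) (_ : Fintype J) (_ : DecidableEq J) (F : Fan n J), ∃ a ∈ F.C, ∃ b ∈ F.C,
      (K ⊆ F.P a ∧ F.P a ⊆ Metric.cthickening ε K) ∧
      (L ⊆ F.P b ∧ F.P b ⊆ Metric.cthickening ε L) := by
  classical
  obtain ⟨GK, hGK, hK1, hK2⟩ := outer hKne hKc hKcv (half_pos hε)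
  obtain ⟨RL, hGL, hL1, hL2⟩ := outer hLne hLc hLcv (half_pos hε)
  obtain ⟨s, hs⟩ := fm2 (GK + RL)
  let s' : Finset ((Fin n → ℝ) →ₗ[ℝ] ℝ) := s ∪ (univ.image (fun i => LinearMap.proj i) ∪
    univ.image (fun i => - LinearMap.proj i))
  let u : s' → (Fin n → ℝ) →ₗ[ℝ] ℝ := fun j => j.1
  let sup : ∀ G : Finset (Fin n → ℝ), G.Nonempty → s' → ℝ := fun G hG j => G.sup' hG fun g => u j g
  have hsup : ∀ (G : Finset (Fin n → ℝ)) (hG : G.Nonempty), ∀ x ∈ convexHull ℝ (G : Set (Fin n → ℝ)), ∀ j, u j x ≤ sup G hG j := by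
    intro G hG x hx j
    have : convexHull ℝ (G : Set (Fin n → ℝ)) ⊆ {y | u j y ≤ sup G hG j} :=
      convexHull_min (fun g hg => le_sup' (fun g => u j g) hg)
        (convex_halfSpace_le (u j).isLinear _)
    exact this hx
  have hPs : ∀ x, (∀ j, u j x ≤ (sup GK hGK + sup RL hGL) j) →
      x ∈ convexHull ℝ (GK : Set (Fin n → ℝ)) + convexHull ℝ (RL : Set (Fin n → ℝ)) := by
    intro x hx
    rw [← convexHull_add, ← Finset.coe_add]
    refine hs x fun a ha => ?_
    have hj := hx ⟨a, mem_union_left _ ha⟩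
    obtain ⟨gk, hgk, e1⟩ := exists_mem_eq_sup' hGK fun g => a g
    obtain ⟨gl, hgl, e2⟩ := exists_mem_eq_sup' hGL fun g => a g
    refine ⟨gk + gl, add_mem_add hgk hgl, ?_⟩
    rw [map_add, ← e1, ← e2]
    exact hj
  obtain ⟨F, hFu, h0, hh0, hP0, hB⟩ := construct u (sup GK hGK + sup RL hGL) (by
    obtain ⟨x, hx⟩ := hKne
    obtain ⟨y, hy⟩ := hLne
    refine ⟨x + y, fun j => ?_⟩
    rw [map_add]
    exact add_le_add (hsup _ _ x (hK1 hx) j) (hsup _ _ y (hL1 hy) j)) (by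
    intro i
    refine ⟨⟨⟨LinearMap.proj i, ?_⟩, rfl⟩, ⟨⟨- LinearMap.proj i, ?_⟩, rfl⟩⟩
    · exact mem_union_right _ (mem_union_left _ (mem_image_of_mem _ (mem_univ _)))
    · exact mem_union_right _ (mem_union_right _ (mem_image.2 ⟨i, mem_univ _, rfl⟩)))
  have hmem : ∀ (G : Finset (Fin n → ℝ)) (hG : G.Nonempty), ∀ x ∈ convexHull ℝ (G : Set (Fin n → ℝ)), x ∈ F.P (sup G hG) := by
    intro G hG x hx j
    rw [hFu]; exact hsup G hG x hx j
  have hkl : ∀ S ∈ F.B, F.X S (sup GK hGK) ∈ convexHull ℝ (GK : Set (Fin n → ℝ)) ∧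
      F.X S (sup RL hGL) ∈ convexHull ℝ (RL : Set (Fin n → ℝ)) := by
    intro S hS
    have h1 := hB S hS
    obtain ⟨k, hk, l, hl, hkl⟩ := hPs _ (fun j => by have := h1 j; rwa [hFu] at this)
    have ht : ∀ i ∈ S, F.u i k = sup GK hGK i ∧ F.u i l = sup RL hGL i := by
      intro i hi
      have e1 := F.tight S hS (sup GK hGK + sup RL hGL) i hi
      rw [← hkl, Pi.add_apply, map_add] at e1
      have e2 := hmem _ hGK k hk i
      have e3 := hmem _ hGL l hl i
      constructor <;> linarith
    rw [F.Xuniq hS fun i hi => (ht i hi).1, F.Xuniq hS fun i hi => (ht i hi).2]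
    exact ⟨hk, hl⟩
  obtain ⟨a, ha, ha'⟩ := F.side hKcv hε (hK := sup GK hGK)
    (fun S hS => ⟨hmem _ _ _ (hkl S hS).1, hK2 (hkl S hS).1⟩) (fun x hx => hmem _ _ _ (hK1 hx)) hh0 hP0
  obtain ⟨b, hb, hb'⟩ := F.side hLcv hε (hK := sup RL hGL)
    (fun S hS => ⟨hmem _ _ _ (hkl S hS).2, hL2 (hkl S hS).2⟩) (fun x hx => hmem _ _ _ (hL1 hx)) hh0 hP0
  exact ⟨s', inferInstance, inferInstance, F, a, ha, b, hb, ha', hb'⟩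

lemma sum_sub {n : ℕ} {ι : Type*} (T : Finset ι) (M A : ι → Set (Fin n → ℝ))
    (hM : ∀ i, IsCompact (M i)) {ε : ℝ} (hε : 0 ≤ ε) (hA : ∀ i, A i ⊆ Metric.cthickening ε (M i)) :
    ∑ i ∈ T, A i ⊆ ∑ i ∈ T, M i + Metric.closedBall 0 (T.card * ε) := by
  classical
  induction T using Finset.induction_on with
  | empty => simp
  | insert i T hi ih =>
    rw [sum_insert hi, sum_insert hi, card_insert_of_notMem hi]
    rintro _ ⟨x, hx, y, hy, rfl⟩
    have hx := hA i hx
    rw [← (hM i).add_closedBall_zero hε] at hx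
    obtain ⟨x1, hx1, x2, hx2, rfl⟩ := hx
    obtain ⟨y1, hy1, y2, hy2, rfl⟩ := ih hy
    refine ⟨x1 + y1, Set.add_mem_add hx1 hy1, x2 + y2, ?_, by dsimp only; abel⟩
    rw [mem_closedBall_zero_iff] at *
    have := norm_add_le x2 y2
    push_cast
    linarith

lemma sum_compact {n : ℕ} {ι : Type*} (T : Finset ι) (M : ι → Set (Fin n → ℝ))
    (hM : ∀ i, IsCompact (M i)) : IsCompact (∑ i ∈ T, M i) := by
  classical
  induction T using Finset.induction_on with
  | empty => rw [sum_empty]; exact isCompact_singleton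
  | insert i T hi ih => rw [sum_insert hi]; exact (hM i).add ih

lemma sum_mono {n : ℕ} {ι : Type*} (T : Finset ι) (M A : ι → Set (Fin n → ℝ))
    (hM : ∀ i, M i ⊆ A i) : ∑ i ∈ T, M i ⊆ ∑ i ∈ T, A i := by
  classical
  induction T using Finset.induction_on with
  | empty => simp
  | insert i T hi ih => rw [sum_insert hi, sum_insert hi]; exact Set.add_subset_add (hM i) ih

lemma vol_lim {n : ℕ} {ι : Type*} (T : Finset ι) (M : ι → Set (Fin n → ℝ))
    (A : ℕ → ι → Set (Fin n → ℝ)) (hM : ∀ i, IsCompact (M i))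
    (h1 : ∀ m i, M i ⊆ A m i) (h2 : ∀ m i, A m i ⊆ Metric.cthickening (1 / ((m : ℝ) + 1)) (M i)) :
    Filter.Tendsto (fun m => vol (∑ i ∈ T, A m i)) Filter.atTop (nhds (vol (∑ i ∈ T, M i))) := by
  unfold vol
  have hc := sum_compact T M hM
  refine (ENNReal.tendsto_toReal hc.measure_lt_top.ne).comp ?_
  have h0 : Filter.Tendsto (fun m : ℕ => (T.card : ℝ) * (1 / ((m : ℝ) + 1))) Filter.atTop (nhds 0) := by
    have := tendsto_one_div_add_atTop_nhds_zero_nat (𝕜 := ℝ)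
    simpa using this.const_mul (T.card : ℝ)
  have h3 := (tendsto_measure_cthickening_of_isCompact (μ := volume) hc).comp h0
  refine tendsto_of_tendsto_of_tendsto_of_le_of_le tendsto_const_nhds h3 (fun m => ?_) (fun m => ?_)
  · exact measure_mono (sum_mono T _ _ (h1 m))
  · refine measure_mono ((sum_sub T M (A m) hM (by positivity) (h2 m)).trans ?_)
    rw [hc.add_closedBall_zero (by positivity)]

lemma MV_lim {n : ℕ} (M : Fin n → Set (Fin n → ℝ))
    (A : ℕ → Fin n → Set (Fin n → ℝ)) (hM : ∀ i, IsCompact (M i))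
    (h1 : ∀ m i, M i ⊆ A m i) (h2 : ∀ m i, A m i ⊆ Metric.cthickening (1 / ((m : ℝ) + 1)) (M i)) :
    Filter.Tendsto (fun m => MV n (A m)) Filter.atTop (nhds (MV n M)) := by
  unfold MV
  exact tendsto_finsetSum _ fun j _ => (tendsto_finsetSum _ fun S _ =>
    vol_lim S M A hM h1 h2).const_mul _

end AFx

theorem hodge_corollary_one {n p q : ℕ} (hq : 1 ≤ q) (hqp : q ≤ p) (hpn : p ≤ n)
    (K L : Set (Fin n → ℝ))
    (hKne : K.Nonempty) (hKc : IsCompact K) (hKcv : Convex ℝ K)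
    (hLne : L.Nonempty) (hLc : IsCompact L) (hLcv : Convex ℝ L) :
    MV n (fun j => if (j : ℕ) < q then K else L) ^ p ≥
      MV n (fun j => if (j : ℕ) < p then K else L) ^ q *
        ((n.factorial : ℝ) * vol L) ^ (p - q) := by
  have hap : ∀ m : ℕ, ∃ A B : Set (Fin n → ℝ),
      ((K ⊆ A ∧ A ⊆ Metric.cthickening (1 / ((m : ℝ) + 1)) K) ∧
      (L ⊆ B ∧ B ⊆ Metric.cthickening (1 / ((m : ℝ) + 1)) L)) ∧
      MV n (fun j => if (j : ℕ) < q then A else B) ^ p ≥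
        MV n (fun j => if (j : ℕ) < p then A else B) ^ q *
          ((n.factorial : ℝ) * vol B) ^ (p - q) := by
    intro m
    obtain ⟨J, _, _, F, a, ha, b, hb, h⟩ := AFx.approx hKne hKc hKcv hLne hLc hLcv
      (ε := 1 / ((m : ℝ) + 1)) (by positivity)
    exact ⟨F.P a, F.P b, h, F.final hq hqp hpn ha hb⟩
  choose A B hAB hle using hap
  have lim : ∀ k : ℕ, Filter.Tendsto (fun m => MV n (fun j => if (j : ℕ) < k then A m else B m))
      Filter.atTop (nhds (MV n (fun j => if (j : ℕ) < k then K else L))) := by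
    intro k
    refine AFx.MV_lim (fun j => if (j : ℕ) < k then K else L)
      (fun m j => if (j : ℕ) < k then A m else B m) (fun i => ?_) (fun m i => ?_) (fun m i => ?_)
    · split_ifs <;> assumption
    · split_ifs
      exacts [(hAB m).1.1, (hAB m).2.1]
    · split_ifs
      exacts [(hAB m).1.2, (hAB m).2.2]
  have limv : Filter.Tendsto (fun m => vol (B m)) Filter.atTop (nhds (vol L)) := by
    have := AFx.vol_lim ({()} : Finset Unit) (fun _ => L) (fun m _ => B m) (fun _ => hLc)
      (fun m _ => (hAB m).2.1) (fun m _ => (hAB m).2.2)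
    simpa using this
  exact le_of_tendsto_of_tendsto' (((lim p).pow q).mul ((limv.const_mul _).pow _)) ((lim q).pow p) hle
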